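/- Let F = ℚ(√d) with d ≥ 6 squarefree and let H be a totally definite quaternion F-algebra. Then t(H, S₄) = t(H, D₄), and both equal 1 if H is F-isomorphic to (−1,−1/F) and 2ε ∈ F^{×2}, and both equal 0 otherwise. (Here S₄ is the symmetric group on 4 letters and D₄ the dihedral group of order 8.) -/

import Mathlib

open NumberField Quaternion

noncomputable section

namespace QuatPaper

variable (F : Type) [Field F] [NumberField F]

def scalarSet (H : Type) [Ring H] [Algebra F H] : Set H :=
  Set.range fun r : 𝓞 F => algebraMap F H (algebraMap (𝓞 F) F r)

def IsOrder {H : Type} [Ring H] [Algebra F H] (O : Subring H) : Prop :=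
  scalarSet F H ⊆ ↑O ∧ O.toAddSubgroup.FG ∧ Submodule.span F (O : Set H) = ⊤

def IsMaximalOrder {H : Type} [Ring H] [Algebra F H] (O : Subring H) : Prop :=
  IsOrder F O ∧ ∀ O' : Subring H, IsOrder F O' → O ≤ O' → O' = O

def IsScalarUnit {H : Type} [Ring H] [Algebra F H] {O : Subring H} (u : (↥O)ˣ) : Prop :=
  ∃ r : (𝓞 F)ˣ, ((u : ↥O) : H) = algebraMap F H (algebraMap (𝓞 F) F ↑r)

def RedUnitIso {H : Type} [Ring H] [Algebra F H] (O : Subring H) (G : Type*) [Group G] : Prop :=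
  ∃ φ : (↥O)ˣ →* G, Function.Surjective φ ∧ ∀ u, φ u = 1 ↔ IsScalarUnit F u

def IsConjugate {H : Type} [Ring H] (x : Hˣ) (O O' : Subring H) : Prop :=
  ∀ y : H, y ∈ O ↔ (x : H) * y * ((x⁻¹ : Hˣ) : H) ∈ O'

def ConjRel {H : Type} [Ring H] (O O' : Subring H) : Prop :=
  ∃ x : Hˣ, IsConjugate x O O'

def typeNum (H : Type) [Ring H] [Algebra F H] (G : Type*) [Group G] : ℕ :=
  Nat.card (Quot fun O O' : {O : Subring H // IsMaximalOrder F O ∧ RedUnitIso F O G} =>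
    ConjRel O.1 O'.1)

def IsQuatAlg (H : Type) [Ring H] [Algebra F H] : Prop :=
  ∃ a b : F, a ≠ 0 ∧ b ≠ 0 ∧ Nonempty (H ≃ₐ[F] ℍ[F, a, b])

def TotallyDefinite (H : Type) [Ring H] [Algebra F H] : Prop :=
  ∀ σ : F →+* ℝ,
    letI : Algebra F ℝ := σ.toAlgebra
    ∀ x : TensorProduct F ℝ H, x ≠ 0 → IsUnit x

section Integrality

open Polynomial in
/-- The coefficients of the reduced characteristic equation of an integral non-scalar element of
an algebra are integral. -/
theorem isIntegral_of_quadratic {K H : Type*} [Field K] [Ring H] [Algebra K H] [Nontrivial H]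
    {x : H} (hx : IsIntegral ℤ x) {τ n : K}
    (hq : x * x = τ • x - algebraMap K H n) (hns : ∀ a : K, algebraMap K H a ≠ x) :
    IsIntegral ℤ τ ∧ IsIntegral ℤ n := by
  obtain ⟨p, hp, hpx⟩ := hx
  have hpx' : aeval x (p.map (algebraMap ℤ K)) = 0 := by
    rw [aeval_map_algebraMap]; exact hpx
  let q : K[X] := X ^ 2 - C τ * X + C n
  have hqdeg : (C τ * X - C n : K[X]).degree < (2 : ℕ) := by
    refine (degree_sub_le _ _).trans_lt (max_lt ?_ ?_)
    · exact (degree_C_mul_X_le τ).trans_lt (by norm_num)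
    · exact degree_C_le.trans_lt (by norm_num)
  have hq' : q = X ^ 2 - (C τ * X - C n) := by simp only [q]; ring
  have hqm : q.Monic := by
    rw [hq']; exact monic_X_pow_sub hqdeg
  have hqd : q.degree = 2 := by
    rw [hq', degree_sub_eq_left_of_degree_lt] <;> simp
    simpa using hqdeg
  have hqx : aeval x q = 0 := by
    simp only [q, map_add, map_sub, map_mul, aeval_X, aeval_C, pow_two, hq,
      Algebra.smul_def]
    abel
  have hdvd : q ∣ p.map (algebraMap ℤ K) := by
    rw [← modByMonic_eq_zero_iff_dvd hqm]
    set r := p.map (algebraMap ℤ K) %ₘ q with hr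
    have hrdeg : r.degree < 2 := hqd ▸ degree_modByMonic_lt _ hqm
    have hrx : aeval x r = 0 := by
      rw [hr, modByMonic_eq_sub_mul_div, map_sub, map_mul, hqx, hpx']
      simp
    have hr1 : r = C (r.coeff 1) * X + C (r.coeff 0) :=
      eq_X_add_C_of_degree_le_one (Order.le_of_lt_succ hrdeg)
    rw [hr1] at hrx
    simp only [map_add, map_mul, aeval_X, aeval_C] at hrx
    by_cases h1 : r.coeff 1 = 0
    · rw [h1] at hrx
      simp only [map_zero, zero_mul, zero_add, map_eq_zero] at hrx
      rw [hr1, h1, hrx]; simp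
    · refine absurd ?_ (hns (-(r.coeff 1)⁻¹ * r.coeff 0))
      have hx : x = algebraMap K H ((r.coeff 1)⁻¹) * (algebraMap K H (r.coeff 1) * x) := by
        rw [← mul_assoc, ← map_mul, inv_mul_cancel₀ h1, map_one, one_mul]
      rw [hx, eq_neg_of_add_eq_zero_left hrx, map_mul, map_neg]
      simp
  have hc := isIntegral_coeff_of_dvd p q hp hqm hdvd
  constructor
  · simpa [q, coeff_X, coeff_C] using (hc 1).neg
  · simpa [q, coeff_X, coeff_C] using hc 0

theorem IsOrder.isIntegral {K H : Type} [Field K] [Ring H] [Algebra K H] {O : Subring H}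
    (hO : IsOrder K O)
    {x : H} (hx : x ∈ O) : IsIntegral ℤ x := by
  refine IsIntegral.of_mem_of_fg (subalgebraOfSubring O) ?_ x hx
  have := hO.2.1
  rwa [← AddSubgroup.toIntSubmodule_toAddSubgroup O.toAddSubgroup, 
    ← Submodule.fg_iff_addSubgroup_fg] at this

theorem isIntegral_of_algebraMap {K H : Type*} [Field K] [Ring H] [Algebra K H] [Nontrivial H]
    {a : K} (h : IsIntegral ℤ (algebraMap K H a)) : IsIntegral ℤ a := by
  rwa [isIntegral_algebraMap_iff (algebraMap K H).injective] at h

end Integrality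

/-- The real quadratic field `ℚ(√d)` with a real embedding and its fundamental unit. -/
structure RealQuadratic where
  d : ℕ
  six_le : 6 ≤ d
  squarefree : Squarefree d
  sqrtd : F
  sq_sqrtd : sqrtd ^ 2 = (d : F)
  adjoin_eq_top : Algebra.adjoin ℚ {sqrtd} = ⊤
  σ : F →+* ℝ
  ε : (𝓞 F)ˣ
  one_lt : 1 < σ (algebraMap (𝓞 F) F ↑ε)
  le_of_one_lt : ∀ u : (𝓞 F)ˣ, 1 < σ (algebraMap (𝓞 F) F ↑u) →
    σ (algebraMap (𝓞 F) F ↑ε) ≤ σ (algebraMap (𝓞 F) F ↑u)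

namespace RealQuadratic

variable {F}

theorem isInt_of_mul_sq {d : ℕ} (hd : Squarefree d) {q : ℚ} {m : ℤ} (h : (d : ℚ) * q ^ 2 = m) :
    ∃ n : ℤ, q = n := by
  have hden : q.den = 1 := by
    have hq : (q.den : ℚ) ≠ 0 := by exact_mod_cast q.den_nz
    have h1 : (d : ℤ) * q.num ^ 2 = (q.den : ℤ) ^ 2 * m := by
      rw [← Rat.num_div_den q] at h
      field_simp at h
      exact_mod_cast h
    have h2 : q.den ^ 2 ∣ d * q.num.natAbs ^ 2 := by
      have := Int.natAbs_dvd_natAbs.mpr (Dvd.intro _ h1.symm)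
      simpa [Int.natAbs_mul, Int.natAbs_pow] using this
    have h3 : q.den ^ 2 ∣ d :=
      Nat.Coprime.dvd_of_dvd_mul_right (Nat.Coprime.pow 2 2 q.reduced.symm) h2
    exact Nat.isUnit_iff.mp (hd _ (by rwa [← pow_two]))
  exact ⟨q.num, (Rat.coe_int_num_of_den_eq_one hden).symm⟩

theorem not_isSquare (S : RealQuadratic F) : ¬ IsSquare (S.d : ℚ) := by
  rintro ⟨r, hr⟩
  have h : ∃ n : ℤ, r = n := by
    refine isInt_of_mul_sq (d := 1) squarefree_one (m := S.d) ?_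
    push_cast
    rw [hr]; ring
  obtain ⟨n, rfl⟩ := h
  have h1 : S.d = n.natAbs * n.natAbs := by
    have : (S.d : ℤ) = n * n := by exact_mod_cast hr
    rw [← Int.natAbs_mul, ← this]; simp
  have h2 := S.squarefree n.natAbs ⟨1, by rw [mul_one]; exact h1⟩
  rw [Nat.isUnit_iff] at h2
  rw [h2] at h1
  have := S.six_le
  omega

theorem irreducible (S : RealQuadratic F) :
    Irreducible (Polynomial.X ^ 2 - Polynomial.C (S.d : ℚ)) :=
  by
  rw [X_pow_sub_C_irreducible_iff_of_prime Nat.prime_two]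
  rintro b hb
  exact S.not_isSquare ⟨b, by rw [← hb, pow_two]⟩

theorem minpoly_sqrtd (S : RealQuadratic F) :
    minpoly ℚ S.sqrtd = Polynomial.X ^ 2 - Polynomial.C (S.d : ℚ) := by
  symm
  apply minpoly.eq_of_irreducible_of_monic S.irreducible
  · simp [S.sq_sqrtd]
  · exact Polynomial.monic_X_pow_sub_C _ two_ne_zero

theorem isIntegral_sqrtd (S : RealQuadratic F) : IsIntegral ℚ S.sqrtd :=
  Algebra.IsIntegral.isIntegral _

def powerBasis (S : RealQuadratic F) : PowerBasis ℚ F :=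
  PowerBasis.ofAdjoinEqTop S.isIntegral_sqrtd S.adjoin_eq_top

theorem powerBasis_gen (S : RealQuadratic F) : S.powerBasis.gen = S.sqrtd := by simp [powerBasis]

theorem finrank_eq_two (S : RealQuadratic F) : Module.finrank ℚ F = 2 := by
  rw [S.powerBasis.finrank, ← S.powerBasis.natDegree_minpoly, S.powerBasis_gen, S.minpoly_sqrtd,
    Polynomial.natDegree_X_pow_sub_C]

/-- The nontrivial automorphism of the quadratic field. -/
def conj (S : RealQuadratic F) : F →ₐ[ℚ] F :=
  S.powerBasis.lift (-S.sqrtd) (by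
    rw [S.powerBasis_gen, S.minpoly_sqrtd]
    simp [S.sq_sqrtd])

theorem conj_sqrtd (S : RealQuadratic F) : S.conj S.sqrtd = -S.sqrtd := by
  have := S.powerBasis.lift_gen (-S.sqrtd) (by
    rw [S.powerBasis_gen, S.minpoly_sqrtd]
    simp [S.sq_sqrtd])
  have h : S.conj S.powerBasis.gen = -S.sqrtd := this
  rwa [S.powerBasis_gen] at h

theorem exists_rat (S : RealQuadratic F) (x : F) : ∃ p q : ℚ, x = p + q * S.sqrtd := by
  have hx : x ∈ Algebra.adjoin ℚ {S.sqrtd} := S.adjoin_eq_top ▸ Algebra.mem_top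
  induction hx using Algebra.adjoin_induction with
  | mem x hx =>
    rw [Set.mem_singleton_iff] at hx
    exact ⟨0, 1, by simp [hx]⟩
  | algebraMap r => exact ⟨r, 0, by simp⟩
  | add x y _ _ hx hy =>
    obtain ⟨p, q, rfl⟩ := hx
    obtain ⟨p', q', rfl⟩ := hy
    exact ⟨p + p', q + q', by push_cast; ring⟩
  | mul x y _ _ hx hy =>
    obtain ⟨p, q, rfl⟩ := hx
    obtain ⟨p', q', rfl⟩ := hy
    refine ⟨p * p' + q * q' * S.d, p * q' + q * p', ?_⟩
    push_cast
    linear_combination (q * q' : F) * S.sq_sqrtd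

theorem rat_eq (S : RealQuadratic F) {p q : ℚ} (h : (p : F) + q * S.sqrtd = 0) : p = 0 ∧ q = 0 := by
  have hq : q = 0 := by
    by_contra hq
    have hq' : (q : F) ≠ 0 := by exact_mod_cast hq
    refine S.not_isSquare ⟨p / q, ?_⟩
    have h1 : S.sqrtd = -p / q := by
      field_simp
      linear_combination h
    have h2 := S.sq_sqrtd
    rw [h1] at h2
    have h3 : (((S.d : ℚ) : ℚ) : F) = ((p / q * (p / q) : ℚ) : F) := by
      push_cast
      rw [← h2]
      ring
    exact_mod_cast h3
  subst hq
  simpa using h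

theorem conj_apply (S : RealQuadratic F) (p q : ℚ) :
    S.conj (p + q * S.sqrtd) = p - q * S.sqrtd := by
  simp [S.conj_sqrtd, sub_eq_add_neg]

theorem sq_ne_two (S : RealQuadratic F) (x : F) : x ^ 2 ≠ 2 := by
  intro h
  obtain ⟨p, q, rfl⟩ := S.exists_rat x
  have h1 : ((p ^ 2 + S.d * q ^ 2 - 2 : ℚ) : F) + ((2 * p * q : ℚ) : F) * S.sqrtd = 0 := by
    push_cast
    linear_combination h - (q ^ 2 : F) * S.sq_sqrtd
  obtain ⟨h2, h3⟩ := S.rat_eq h1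
  have hsq : ∀ n : ℤ, n ^ 2 ≠ 2 := by
    intro n hn
    have : n < 2 := by nlinarith
    have : -2 < n := by nlinarith
    interval_cases n <;> simp at hn
  rcases mul_eq_zero.mp h3 with h4 | h4
  · have hp : p = 0 := by simpa using h4
    subst hp
    obtain ⟨n, rfl⟩ := isInt_of_mul_sq S.squarefree (q := q) (m := 2) (by push_cast; linarith)
    have h5 : (S.d : ℤ) * n ^ 2 = 2 := by
      have : ((S.d : ℤ) * n ^ 2 : ℚ) = 2 := by push_cast; linarith
      exact_mod_cast this
    have h6 : (6 : ℤ) ≤ S.d := by exact_mod_cast S.six_le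
    have h7 : n ≠ 0 := by rintro rfl; simp at h5
    have h8 : 1 ≤ n ^ 2 := by have := sq_pos_of_ne_zero h7; omega
    nlinarith
  · subst h4
    obtain ⟨n, rfl⟩ := isInt_of_mul_sq squarefree_one (q := p) (m := 2) (by push_cast; linarith)
    refine hsq n ?_
    have : (n ^ 2 : ℚ) = 2 := by linarith
    exact_mod_cast this

/-- The value of a unit under the distinguished real embedding. -/
theorem unit_eq_zpow (S : RealQuadratic F) (u : (𝓞 F)ˣ) (hu : 0 < S.σ (algebraMap (𝓞 F) F ↑u)) :
    ∃ k : ℤ, u = S.ε ^ k := by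
  let f : (𝓞 F)ˣ →* ℝ :=
    ((S.σ.comp (algebraMap (𝓞 F) F) : 𝓞 F →+* ℝ) : 𝓞 F →* ℝ).comp (Units.coeHom (𝓞 F))
  have hf : Function.Injective f := fun a b h => Units.ext (RingOfIntegers.ext (S.σ.injective h))
  have hfz : ∀ k : ℤ, f (S.ε ^ k) = f S.ε ^ k := fun k => by
    have h1 : ∀ v : (𝓞 F)ˣ, f v⁻¹ = (f v)⁻¹ := fun v =>
      eq_inv_of_mul_eq_one_left (by rw [← map_mul, inv_mul_cancel, map_one])
    cases k with
    | ofNat n => simp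
    | negSucc n => rw [zpow_negSucc, zpow_negSucc, h1, map_pow]
  have hε : 1 < f S.ε := S.one_lt
  have hu' : 0 < f u := hu
  obtain ⟨k, hk1, hk2⟩ := exists_mem_Ico_zpow hu' hε
  refine ⟨k, ?_⟩
  have hpos : 0 < f S.ε ^ k := zpow_pos (by linarith) k
  have hquot : f (u * S.ε ^ (-k)) = f u / f S.ε ^ k := by
    rw [map_mul, hfz, zpow_neg, div_eq_mul_inv]
  have hle : f (u * S.ε ^ (-k)) ≤ 1 := by
    by_contra! hlt
    have h1 := S.le_of_one_lt (u * S.ε ^ (-k)) hlt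
    change f S.ε ≤ f (u * S.ε ^ (-k)) at h1
    rw [hquot, le_div_iff₀ hpos, ← zpow_one_add₀ (by linarith : f S.ε ≠ 0), add_comm] at h1
    linarith
  rw [hquot, div_le_one hpos] at hle
  exact hf (by rw [hfz]; exact le_antisymm hle hk1)

end RealQuadratic

/-- A real quadratic field in which `2 ε` is the square of an integer `t`. -/
structure Ramified extends RealQuadratic F where
  t : 𝓞 F
  t_sq : t ^ 2 = 2 * (ε : 𝓞 F)

namespace Ramified

variable {F}

theorem t_ne_zero (S : Ramified F) : S.t ≠ 0 := by
  intro h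
  have := S.t_sq
  rw [h] at this
  simp at this

/-- The inverse of the fundamental unit as an integer. -/
def δ (S : Ramified F) : 𝓞 F := ↑S.ε⁻¹

theorem ε_mul_δ (S : Ramified F) : (S.ε : 𝓞 F) * S.δ = 1 := S.ε.mul_inv

theorem two_eq (S : Ramified F) : (2 : 𝓞 F) = S.t * S.t * S.δ := by
  rw [← pow_two, S.t_sq, mul_assoc, S.ε_mul_δ, mul_one]

theorem natAbs_norm_t (S : Ramified F) : (Algebra.norm ℤ S.t).natAbs = 2 := by
  have h1 := congrArg (fun x => (Algebra.norm ℤ x).natAbs) S.t_sq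
  have h2 : Algebra.norm ℤ (2 : 𝓞 F) = 4 := by
    have := Algebra.norm_algebraMap (S := 𝓞 F) (2 : ℤ)
    rw [RingOfIntegers.rank, S.finrank_eq_two] at this
    simpa using this
  have h3 : (Algebra.norm ℤ (S.ε : 𝓞 F)).natAbs = 1 := 
    Int.isUnit_iff_natAbs_eq.mp (S.ε.isUnit.map (Algebra.norm ℤ))
  simp only [map_pow, map_mul, Int.natAbs_pow, Int.natAbs_mul, h2, h3] at h1
  have h4 : (Algebra.norm ℤ S.t).natAbs ^ 2 = 2 ^ 2 := by simpa using h1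
  exact Nat.pow_left_injective two_ne_zero h4

theorem exists_residue (S : Ramified F) :
    ∃ ρ : 𝓞 F →+* ZMod 2, ∀ x, ρ x = 0 ↔ S.t ∣ x := by
  let I : Ideal (𝓞 F) := Ideal.span {S.t}
  have hcard : Nat.card (𝓞 F ⧸ I) = 2 := by
    rw [← S.natAbs_norm_t, ← Ideal.absNorm_span_singleton, Ideal.absNorm_apply,
      Submodule.cardQuot_apply]
  have : Finite (𝓞 F ⧸ I) := Nat.finite_of_card_ne_zero (by rw [hcard]; norm_num)
  have := Fintype.ofFinite (𝓞 F ⧸ I)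
  let e := ZMod.ringEquivOfPrime (𝓞 F ⧸ I) Nat.prime_two
    (by rw [← Nat.card_eq_fintype_card, hcard])
  refine ⟨(e.symm : 𝓞 F ⧸ I →+* ZMod 2).comp (Ideal.Quotient.mk I), fun x => ?_⟩
  rw [RingHom.comp_apply, RingHom.coe_coe, map_eq_zero_iff _ e.symm.injective,
    Ideal.Quotient.eq_zero_iff_mem, Ideal.mem_span_singleton]

/-- Reduction modulo the prime above `2`. -/
def ρ (S : Ramified F) : 𝓞 F →+* ZMod 2 := S.exists_residue.choose

theorem ρ_eq_zero (S : Ramified F) {x : 𝓞 F} : S.ρ x = 0 ↔ S.t ∣ x :=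
  S.exists_residue.choose_spec x

theorem ρ_t (S : Ramified F) : S.ρ S.t = 0 := S.ρ_eq_zero.mpr dvd_rfl

theorem zmod_two_cases (x : ZMod 2) : x = 0 ∨ x = 1 := by
  revert x; decide

theorem ρ_unit (S : Ramified F) (u : (𝓞 F)ˣ) : S.ρ u = 1 :=
  (zmod_two_cases _).resolve_left (u.isUnit.map S.ρ).ne_zero

theorem dvd_sub_of_ρ_eq (S : Ramified F) {x y : 𝓞 F} (h : S.ρ x = S.ρ y) : S.t ∣ x - y := by
  rw [← S.ρ_eq_zero, map_sub, h, sub_self]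

theorem exists_η (S : Ramified F) : ∃ η : 𝓞 F, (S.ε : 𝓞 F) = 1 + S.t * η := by
  obtain ⟨η, hη⟩ := S.dvd_sub_of_ρ_eq (x := S.ε) (y := 1) (by rw [ρ_unit, map_one])
  exact ⟨η, by rw [← hη]; ring⟩

def η (S : Ramified F) : 𝓞 F := S.exists_η.choose

theorem ε_eq (S : Ramified F) : (S.ε : 𝓞 F) = 1 + S.t * S.η := S.exists_η.choose_spec

theorem exists_θ (S : Ramified F) : ∃ θ : 𝓞 F, S.η * S.η = S.η + S.t * θ := by
  obtain ⟨θ, hθ⟩ := S.dvd_sub_of_ρ_eq (x := S.η * S.η) (y := S.η) (by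
    rw [map_mul]; generalize S.ρ S.η = y; revert y; decide)
  exact ⟨θ, by rw [← hθ]; ring⟩

def θ (S : Ramified F) : 𝓞 F := S.exists_θ.choose

theorem η_sq (S : Ramified F) : S.η * S.η = S.η + S.t * S.θ := S.exists_θ.choose_spec

/-- The nontrivial automorphism on the ring of integers. -/
def conjInt (S : Ramified F) : 𝓞 F →+* 𝓞 F :=
  RingOfIntegers.mapRingHom (S.conj : F →+* F)

theorem coe_conjInt (S : Ramified F) (x : 𝓞 F) : (S.conjInt x : F) = S.conj x := rfl

theorem dvd_conjInt_t (S : Ramified F) : S.t ∣ S.conjInt S.t := by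
  have h : S.t ^ 2 ∣ S.conjInt S.t ^ 2 := by
    rw [← map_pow, S.t_sq, map_mul, map_ofNat]
    exact mul_dvd_mul_left _ (S.ε.isUnit.dvd)
  exact (IsIntegrallyClosed.pow_dvd_pow_iff two_ne_zero).mp h

theorem ρ_conjInt (S : Ramified F) (x : 𝓞 F) : S.ρ (S.conjInt x) = S.ρ x := by
  have key : ∀ y, S.ρ y = 0 → S.ρ (S.conjInt y) = 0 := by
    intro y hy
    rw [ρ_eq_zero] at hy ⊢
    exact S.dvd_conjInt_t.trans (map_dvd S.conjInt hy)
  rcases zmod_two_cases (S.ρ x) with h | h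
  · rw [h, key x h]
  · have := key (x - 1) (by rw [map_sub, h, map_one, sub_self])
    rw [map_sub, map_sub, map_one, map_one, sub_eq_zero] at this
    rw [this, h]

theorem exists_int (S : Ramified F) (x : 𝓞 F) :
    ∃ m n : ℤ, (x : F) = m + n * S.sqrtd := by
  obtain ⟨p, q, hpq⟩ := S.exists_rat x
  have hsum : ((x + S.conjInt x : 𝓞 F) : F) = ((2 * p : ℚ) : F) := by
    rw [RingOfIntegers.coe_eq_algebraMap, map_add, ← RingOfIntegers.coe_eq_algebraMap,
      ← RingOfIntegers.coe_eq_algebraMap, coe_conjInt, hpq, S.conj_apply]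
    push_cast; ring
  have hnorm : ((x * S.conjInt x : 𝓞 F) : F) = ((p ^ 2 - S.d * q ^ 2 : ℚ) : F) := by
    rw [RingOfIntegers.coe_eq_algebraMap, map_mul, ← RingOfIntegers.coe_eq_algebraMap,
      ← RingOfIntegers.coe_eq_algebraMap, coe_conjInt, hpq, S.conj_apply]
    push_cast
    linear_combination (-q ^ 2 : F) * S.sq_sqrtd
  have hint : ∀ (y : 𝓞 F) (r : ℚ), (y : F) = (r : F) → ∃ n : ℤ, r = n := by
    intro y r h
    have h1 : IsIntegral ℤ (algebraMap ℚ F r) := by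
      rw [eq_ratCast, ← h]; exact y.isIntegral_coe
    obtain ⟨n, hn⟩ := IsIntegrallyClosed.isIntegral_iff.mp (isIntegral_of_algebraMap h1)
    exact ⟨n, hn.symm⟩
  obtain ⟨m, hm⟩ := hint _ _ hsum
  obtain ⟨N, hN⟩ := hint _ _ hnorm
  have hm2 : (m : ZMod 2) = 0 := by
    have h1 : (m : 𝓞 F) = x + S.conjInt x := RingOfIntegers.ext (by rw [hsum, hm]; simp)
    rw [← map_intCast S.ρ, h1, map_add, ρ_conjInt]
    generalize S.ρ x = y; revert y; decide
  obtain ⟨k, rfl⟩ := (ZMod.intCast_zmod_eq_zero_iff_dvd m 2).mp hm2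
  have hp : p = k := by push_cast at hm; linarith
  obtain ⟨n, hn⟩ := RealQuadratic.isInt_of_mul_sq S.squarefree (q := q) (m := k ^ 2 - N) (by
    rw [hp] at hN; push_cast; linarith)
  exact ⟨k, n, by rw [hpq, hp, hn]; push_cast; rfl⟩

theorem int_of_sum_four_squares (S : Ramified F) {A B C D : 𝓞 F}
    (h : A ^ 2 + B ^ 2 + C ^ 2 + D ^ 2 = 4) :
    ∃ a b c d : ℤ, A = a ∧ B = b ∧ C = c ∧ D = d ∧ a ^ 2 + b ^ 2 + c ^ 2 + d ^ 2 = 4 := by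
  obtain ⟨a, a', ha⟩ := S.exists_int A
  obtain ⟨b, b', hb⟩ := S.exists_int B
  obtain ⟨c, c', hc⟩ := S.exists_int C
  obtain ⟨d, d', hd⟩ := S.exists_int D
  have h1 := congrArg (algebraMap (𝓞 F) F) h
  simp only [map_add, map_pow, ha, hb, hc, hd, map_ofNat] at h1
  obtain ⟨h2, -⟩ := S.rat_eq
    (p := a ^ 2 + b ^ 2 + c ^ 2 + d ^ 2 + S.d * (a' ^ 2 + b' ^ 2 + c' ^ 2 + d' ^ 2) - 4)
    (q := 2 * (a * a' + b * b' + c * c' + d * d')) (by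
      push_cast
      linear_combination h1 - (a' ^ 2 + b' ^ 2 + c' ^ 2 + d' ^ 2 : F) * S.sq_sqrtd)
  have h3 : a ^ 2 + b ^ 2 + c ^ 2 + d ^ 2 + S.d * (a' ^ 2 + b' ^ 2 + c' ^ 2 + d' ^ 2) - 4 = 0 := by
    exact_mod_cast h2
  have h6 : (6 : ℤ) ≤ S.d := by exact_mod_cast S.six_le
  have h0 : a' ^ 2 + b' ^ 2 + c' ^ 2 + d' ^ 2 = 0 := by
    by_contra hne
    have : 1 ≤ a' ^ 2 + b' ^ 2 + c' ^ 2 + d' ^ 2 :=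
      Int.add_one_le_iff.mpr (lt_of_le_of_ne (by positivity) (Ne.symm hne))
    nlinarith [sq_nonneg a, sq_nonneg b, sq_nonneg c, sq_nonneg d]
  have hz : ∀ {x y z w : ℤ}, x ^ 2 + y ^ 2 + z ^ 2 + w ^ 2 = 0 → x = 0 := by
    intro x y z w h
    have : x ^ 2 = 0 := by nlinarith [sq_nonneg x, sq_nonneg y, sq_nonneg z, sq_nonneg w]
    simpa using this
  have ha' : a' = 0 := hz h0
  have hb' : b' = 0 := hz (y := a') (z := c') (w := d') (by linarith)
  have hc' : c' = 0 := hz (y := a') (z := b') (w := d') (by linarith)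
  have hd' : d' = 0 := hz (y := a') (z := b') (w := c') (by linarith)
  subst ha' hb' hc' hd'
  refine ⟨a, b, c, d, ?_, ?_, ?_, ?_, by linarith⟩ <;> apply RingOfIntegers.ext
  · simpa using ha
  · simpa using hb
  · simpa using hc
  · simpa using hd

end Ramified

section Transport

variable {K H H' : Type} [Field K] [Ring H] [Algebra K H] [Ring H'] [Algebra K H']

theorem map_symm_map (e : H ≃ₐ[K] H') (O : Subring H) :
    (O.map (e : H →+* H')).map (e.symm : H' →+* H) = O := by
  ext x
  simp [Subring.mem_map]

theorem IsOrder.map (e : H ≃ₐ[K] H') {O : Subring H} (hO : IsOrder K O) :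
    IsOrder K (O.map (e : H →+* H')) := by
  obtain ⟨h1, h2, h3⟩ := hO
  refine ⟨?_, ?_, ?_⟩
  · rintro _ ⟨r, rfl⟩
    exact ⟨_, h1 ⟨r, rfl⟩, by simp⟩
  · obtain ⟨S, hS⟩ := h2
    classical
    refine ⟨S.image e, ?_⟩
    rw [Finset.coe_image]
    refine (AddMonoidHom.map_closure (e : H →+ H') (S : Set H)).symm.trans ?_
    rw [hS]
    rfl
  · have : ((O.map (e : H →+* H') : Subring H') : Set H') = e.toLinearMap '' (O : Set H) := by
      ext x; simp
    rw [this, ← Submodule.map_span, h3, Submodule.map_top, LinearMap.range_eq_top]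
    exact e.surjective

theorem IsMaximalOrder.map (e : H ≃ₐ[K] H') {O : Subring H} (hO : IsMaximalOrder K O) :
    IsMaximalOrder K (O.map (e : H →+* H')) := by
  refine ⟨hO.1.map e, fun O' hO' hle => ?_⟩
  have h := hO.2 (O'.map (e.symm : H' →+* H)) (hO'.map e.symm) (by
    rw [← map_symm_map e O]
    rintro _ ⟨x, hx, rfl⟩
    exact ⟨x, hle hx, rfl⟩)
  rw [← h]
  exact (map_symm_map e.symm O').symm

theorem RedUnitIso.map (e : H ≃ₐ[K] H') {O : Subring H} {G : Type*} [Group G]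
    (hO : RedUnitIso K O G) : RedUnitIso K (O.map (e : H →+* H')) G := by
  obtain ⟨φ, hφ, hker⟩ := hO
  let f : O ≃+* O.map (e : H →+* H') := (e : H ≃+* H').subringMap (s := O)
  let g : (↥O)ˣ ≃* (O.map (e : H →+* H'))ˣ := Units.mapEquiv f.toMulEquiv
  refine ⟨φ.comp g.symm.toMonoidHom, hφ.comp g.symm.surjective, fun u => ?_⟩
  obtain ⟨v, rfl⟩ := g.surjective u
  have h1 : g.symm.toMonoidHom (g v) = v := g.symm_apply_apply v
  have h2 : ((g v : O.map (e : H →+* H')) : H') = e (v : O) := rfl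
  rw [MonoidHom.comp_apply, hker, h1]
  unfold IsScalarUnit
  rw [h2]
  refine exists_congr fun r => ⟨fun h => by rw [h, e.commutes], fun h => e.injective ?_⟩
  rw [h, e.commutes]

end Transport

section SkolemNoether

variable {K : Type} [Field K]

theorem exists_intertwiner [CharZero K] (f : ℍ[K,-1,-1] →ₐ[K] ℍ[K,-1,-1]) :
    ∃ x : ℍ[K,-1,-1], x ≠ 0 ∧ ∀ q, x * q = f q * x := by
  let i : ℍ[K,-1,-1] := ⟨0, 1, 0, 0⟩
  let j : ℍ[K,-1,-1] := ⟨0, 0, 1, 0⟩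
  let k : ℍ[K,-1,-1] := ⟨0, 0, 0, 1⟩
  have hii : i * i = -1 := by ext <;> simp [i]
  have hjj : j * j = -1 := by ext <;> simp [j]
  have hkk : k * k = -1 := by ext <;> simp [k]
  have hij : i * j = k := by ext <;> simp [i, j, k]
  have hji : j * i = -k := by ext <;> simp [i, j, k]
  have hjk : j * k = i := by ext <;> simp [i, j, k]
  have hkj : k * j = -i := by ext <;> simp [i, j, k]
  have hki : k * i = j := by ext <;> simp [i, j, k]
  have hik : i * k = -j := by ext <;> simp [i, j, k]
  have hf : ∀ a b c, a * b = c → ∀ z, f a * (f b * z) = f c * z := fun a b c h z => by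
    rw [← mul_assoc, ← map_mul, h]
  let s : ℍ[K,-1,-1] → ℍ[K,-1,-1] := fun y =>
    y - f i * (y * i) - f j * (y * j) - f k * (y * k)
  have hsi : ∀ y, s y * i = f i * s y := fun y => by
    simp only [s, sub_mul, mul_sub, mul_assoc, hii, hji, hki, hf _ _ _ hii, hf _ _ _ hij,
      hf _ _ _ hik, map_neg, map_one, neg_mul, mul_neg, one_mul, mul_one]
    abel
  have hsj : ∀ y, s y * j = f j * s y := fun y => by
    simp only [s, sub_mul, mul_sub, mul_assoc, hij, hjj, hkj, hf _ _ _ hji, hf _ _ _ hjj,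
      hf _ _ _ hjk, map_neg, map_one, neg_mul, mul_neg, one_mul, mul_one]
    abel
  have hsum : s 1 - s i * i - s j * j - s k * k = 4 := by
    simp only [s, sub_mul, mul_assoc, hii, hij, hik, hji, hjj, hjk, hki, hkj, hkk, neg_mul,
      mul_neg, one_mul, mul_one]
    abel_nf
    norm_num
  have hne : ∃ y, s y ≠ 0 := by
    by_contra! h
    rw [h, h, h, h] at hsum
    have h4 : (4 : ℍ[K,-1,-1]) = algebraMap K _ 4 := (map_ofNat _ 4).symm
    rw [h4] at hsum
    have := congrArg QuaternionAlgebra.re hsum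
    simp [QuaternionAlgebra.algebraMap_eq] at this
  obtain ⟨y, hy⟩ := hne
  refine ⟨s y, hy, fun q => ?_⟩
  have hq : q = algebraMap K _ q.re + q.imI • i + q.imJ • j + q.imK • (i * j) := by
    ext <;> simp [i, j, QuaternionAlgebra.algebraMap_eq]
  rw [hq]
  simp only [map_add, map_smul, map_mul, AlgHom.commutes, mul_add, add_mul, smul_mul_assoc,
    mul_smul_comm, hsi, hsj, mul_assoc, Algebra.commutes]
  rw [← mul_assoc (s y) i j, hsi, mul_assoc, hsj]

end SkolemNoether

section Definite

variable {K H : Type} [Field K] [Ring H] [Algebra K H]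

theorem IsQuatAlg.nontrivial (h : IsQuatAlg K H) : Nontrivial H := by
  obtain ⟨a, b, -, -, ⟨e⟩⟩ := h
  exact e.toEquiv.nontrivial

theorem IsQuatAlg.finrank_eq_four (h : IsQuatAlg K H) : Module.finrank K H = 4 := by
  obtain ⟨a, b, -, -, ⟨e⟩⟩ := h
  rw [e.toLinearEquiv.finrank_eq, QuaternionAlgebra.finrank_eq_four]

theorem IsQuatAlg.exists_quadratic (h : IsQuatAlg K H) (x : H) :
    ∃ τ n : K, x * x = τ • x - algebraMap K H n := by
  obtain ⟨a, b, -, -, ⟨e⟩⟩ := h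
  set y := e x with hy
  refine ⟨2 * y.re, y.re ^ 2 - a * y.imI ^ 2 - b * y.imJ ^ 2 + a * b * y.imK ^ 2,
    e.injective ?_⟩
  rw [map_mul, map_sub, map_smul, e.commutes, ← hy]
  ext <;> simp [QuaternionAlgebra.algebraMap_eq] <;> ring

theorem TotallyDefinite.sq_neg (h : TotallyDefinite K H) (σ : K →+* ℝ) {v : H}
    (hv : ∀ a : K, algebraMap K H a ≠ v) {r : K} (hr : v * v = algebraMap K H r) : σ r < 0 := by
  by_contra! h0
  let : Algebra K ℝ := σ.toAlgebra
  have hnot : v ∉ Submodule.span K {(1 : H)} := by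
    rw [Submodule.mem_span_singleton]
    rintro ⟨a, ha⟩
    exact hv a (by rw [← ha, Algebra.algebraMap_eq_smul_one])
  obtain ⟨f, hf, hf1⟩ := Submodule.exists_le_ker_of_notMem hnot
  have hf1' : f 1 = 0 := hf1 (Submodule.mem_span_singleton_self 1)
  let g : TensorProduct K ℝ H →ₗ[K] ℝ :=
    (TensorProduct.rid K ℝ).toLinearMap ∘ₗ LinearMap.lTensor ℝ f
  have hg : ∀ (s c : ℝ), g (s ⊗ₜ 1 + c ⊗ₜ v) = σ (f v) * c := fun s c => by
    simp only [g, map_add, LinearMap.comp_apply, LinearMap.lTensor_tmul, hf1',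
      TensorProduct.tmul_zero, zero_add, LinearEquiv.coe_coe, map_zero, TensorProduct.rid_tmul]
    rfl
  have hfv : σ (f v) ≠ 0 := by simpa using hf
  have hX : ∀ (s c : ℝ), c ≠ 0 → (s ⊗ₜ 1 + c ⊗ₜ v : TensorProduct K ℝ H) ≠ 0 :=
    fun s c hc h => mul_ne_zero hfv hc (by rw [← hg s c, h, map_zero])
  have hXY : (√(σ r) ⊗ₜ 1 + (1 : ℝ) ⊗ₜ v : TensorProduct K ℝ H) *
      (√(σ r) ⊗ₜ 1 + (-1 : ℝ) ⊗ₜ v) = 0 := by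
    have hr' : (1 : ℝ) ⊗ₜ[K] algebraMap K H r = σ r ⊗ₜ[K] (1 : H) := by
      rw [Algebra.algebraMap_eq_smul_one, ← TensorProduct.smul_tmul, Algebra.smul_def, mul_one]
      rfl
    simp only [mul_add, add_mul, Algebra.TensorProduct.tmul_mul_tmul, mul_one, one_mul, hr,
      Real.mul_self_sqrt h0, mul_neg, TensorProduct.neg_tmul, hr']
    abel
  exact hX _ _ (by norm_num) ((h σ _ (hX _ _ one_ne_zero)).mul_right_eq_zero.mp hXY)

end Definite

section Units

variable {K H : Type} [Field K] [Ring H] [Algebra K H] {O : Subring H}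

theorem IsOrder.algebraMap_mem (hO : IsOrder K O) (r : 𝓞 K) :
    algebraMap K H (r : K) ∈ O := hO.1 ⟨r, rfl⟩

theorem IsOrder.smul_mem (hO : IsOrder K O) (r : 𝓞 K) {x : H} (hx : x ∈ O) : (r : K) • x ∈ O := by
  rw [Algebra.smul_def]
  exact O.mul_mem (hO.algebraMap_mem r) hx

theorem coe_mul_inv (u : (↥O)ˣ) : ((u : O) : H) * ((u⁻¹ : (↥O)ˣ) : O) = 1 :=
  congrArg Subtype.val u.mul_inv

theorem coe_inv_mul (u : (↥O)ˣ) : (((u⁻¹ : (↥O)ˣ) : O) : H) * (u : O) = 1 :=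
  congrArg Subtype.val u.inv_mul

theorem IsOrder.isScalarUnit [Nontrivial H] (hO : IsOrder K O) (u : (↥O)ˣ) {a : K}
    (h : ((u : O) : H) = algebraMap K H a) : IsScalarUnit K u := by
  have h0 : a ≠ 0 := by
    rintro rfl
    have := coe_mul_inv u
    rw [h, map_zero, zero_mul] at this
    exact zero_ne_one this
  have h' : (((u⁻¹ : (↥O)ˣ) : O) : H) = algebraMap K H a⁻¹ := by
    have := coe_mul_inv u
    rw [h] at this
    calc _ = algebraMap K H a⁻¹ * (algebraMap K H a * (((u⁻¹ : (↥O)ˣ) : O) : H)) := by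
            rw [← mul_assoc, ← map_mul, inv_mul_cancel₀ h0, map_one, one_mul]
      _ = _ := by rw [this, mul_one]
  have i1 : IsIntegral ℤ a := isIntegral_of_algebraMap (h ▸ hO.isIntegral (u : O).2)
  have i2 : IsIntegral ℤ a⁻¹ :=
    isIntegral_of_algebraMap (h' ▸ hO.isIntegral ((u⁻¹ : (↥O)ˣ) : O).2)
  exact ⟨⟨⟨a, i1⟩, ⟨a⁻¹, i2⟩, RingOfIntegers.ext (mul_inv_cancel₀ h0),
    RingOfIntegers.ext (inv_mul_cancel₀ h0)⟩, h⟩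

theorem sq_mul_sq_of_quadratic {x : H} {τ n : K} (h : x * x = τ • x - algebraMap K H n) :
    x * x * (x * x) = (τ ^ 2 - 2 * n) • (x * x) - algebraMap K H (n ^ 2) := by
  have : x * x * (x * x) = (τ • x - algebraMap K H n) * (τ • x - algebraMap K H n) := by rw [h]
  rw [this]
  simp only [Algebra.algebraMap_eq_smul_one, sub_mul, mul_sub, smul_mul_assoc, mul_smul_comm,
    mul_one, one_mul] at h ⊢
  rw [h]
  module

theorem IsOrder.exists_quadratic_unit [Nontrivial H] (hO : IsOrder K O) (hH : IsQuatAlg K H)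
    (u : (↥O)ˣ) (hu : ∀ a : K, algebraMap K H a ≠ (u : O)) :
    ∃ (τ : 𝓞 K) (n : (𝓞 K)ˣ), ((u : O) : H) * (u : O) =
      (τ : K) • ((u : O) : H) - algebraMap K H ((n : 𝓞 K) : K) := by
  obtain ⟨τ, n, hq⟩ := hH.exists_quadratic ((u : O) : H)
  have h1 := coe_mul_inv u
  have h2 := coe_inv_mul u
  set x : H := ((u : O) : H)
  set y : H := (((u⁻¹ : (↥O)ˣ) : O) : H) with hy
  have hn0 : n ≠ 0 := by
    rintro rfl
    refine hu τ ?_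
    calc algebraMap K H τ = (τ • x - algebraMap K H 0) * y := by
            rw [map_zero, sub_zero, smul_mul_assoc, h1, Algebra.algebraMap_eq_smul_one]
      _ = x := by rw [← hq, mul_assoc, h1, mul_one]
  have hxy : x = algebraMap K H τ - n • y := by
    calc x = x * x * y := by rw [mul_assoc, h1, mul_one]
      _ = _ := by
        rw [hq, sub_mul, smul_mul_assoc, h1, ← Algebra.smul_def, Algebra.algebraMap_eq_smul_one]
  have hyy : y * y = (τ / n) • y - algebraMap K H n⁻¹ := by
    have h3 : 1 = τ • y - n • (y * y) := by
      rw [← h1]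
      conv_lhs => rw [hxy]
      rw [sub_mul, smul_mul_assoc, ← Algebra.smul_def]
    calc y * y = n⁻¹ • (n • (y * y)) := by rw [smul_smul, inv_mul_cancel₀ hn0, one_smul]
      _ = n⁻¹ • (τ • y - 1) := by rw [h3]; congr 1; abel
      _ = _ := by
        rw [smul_sub, smul_smul, Algebra.algebraMap_eq_smul_one, div_eq_inv_mul]
  have hyns : ∀ a : K, algebraMap K H a ≠ y := fun a ha => hu (τ - n * a) (by
    rw [map_sub, map_mul, hxy, ← ha, Algebra.smul_def])
  obtain ⟨i1, i2⟩ := isIntegral_of_quadratic (hO.isIntegral (u : O).2) hq hu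
  obtain ⟨-, i3⟩ := isIntegral_of_quadratic (hO.isIntegral ((u⁻¹ : (↥O)ˣ) : O).2) hyy hyns
  exact ⟨⟨τ, i1⟩, ⟨⟨n, i2⟩, ⟨n⁻¹, i3⟩, RingOfIntegers.ext (mul_inv_cancel₀ hn0),
    RingOfIntegers.ext (inv_mul_cancel₀ hn0)⟩, hq⟩

end Units

section FourthRoot

variable {F}
variable {H : Type} [Ring H] [Algebra F H] {O : Subring H}

/-- A unit whose image in the reduced unit group has order four. -/
theorem IsOrder.exists_trace_sq [Nontrivial H] (hO : IsOrder F O) (hH : IsQuatAlg F H)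
    (S : RealQuadratic F) (u : (↥O)ˣ) (h2 : ¬ IsScalarUnit F (u ^ 2))
    (h4 : IsScalarUnit F (u ^ 4)) :
    ∃ (τ : 𝓞 F) (l : ℤ), (τ : F) ^ 2 = 2 * (((S.ε : 𝓞 F) : F) ^ l) ^ 2 * ((S.ε : 𝓞 F) : F) ∧
      ((u : O) : H) * (u : O) =
        (τ : F) • ((u : O) : H) - ((((S.ε : 𝓞 F) : F) ^ l) ^ 2 * ((S.ε : 𝓞 F) : F)) • (1 : H) := by
  have hns2 : ∀ a : F, algebraMap F H a ≠ ((u : O) : H) * (u : O) := fun a ha =>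
    h2 (hO.isScalarUnit _ (a := a) (by rw [ha, pow_two]; rfl))
  have hns : ∀ a : F, algebraMap F H a ≠ (u : O) := fun a ha =>
    hns2 (a * a) (by rw [map_mul, ha])
  obtain ⟨τ, n, hq⟩ := hO.exists_quadratic_unit hH u hns
  obtain ⟨r, hr⟩ := h4
  replace hr : ((u : O) : H) * (u : O) * ((u : O) * (u : O)) = algebraMap F H (r : 𝓞 F) := by
    rw [← RingOfIntegers.coe_eq_algebraMap] at hr
    rw [← hr]
    have : u ^ 4 = u * u * (u * u) := by rw [← pow_two, ← pow_two, ← pow_mul]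
    rw [this]; rfl
  set x : H := ((u : O) : H)
  have hτn : (τ : F) ^ 2 = 2 * ((n : 𝓞 F) : F) := by
    by_contra hne
    have hne' : (τ : F) ^ 2 - 2 * ((n : 𝓞 F) : F) ≠ 0 := sub_ne_zero.mpr hne
    have e : ((τ : F) ^ 2 - 2 * ((n : 𝓞 F) : F)) • (x * x) =
        algebraMap F H ((r : 𝓞 F) + ((n : 𝓞 F) : F) ^ 2) := by
      rw [map_add, ← hr]
      rw [sq_mul_sq_of_quadratic hq, map_pow]
      abel
    refine hns2 (((τ : F) ^ 2 - 2 * ((n : 𝓞 F) : F))⁻¹ * ((r : 𝓞 F) + ((n : 𝓞 F) : F) ^ 2)) ?_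
    rw [map_mul, ← e, ← Algebra.smul_def, smul_smul, inv_mul_cancel₀ hne', one_smul]
  have hn0 : ((n : 𝓞 F) : F) ≠ 0 := by
    simp
  have hpos : 0 < S.σ (algebraMap (𝓞 F) F n) := by
    have := congrArg S.σ hτn
    rw [map_pow, map_mul, map_ofNat] at this
    have h0 : S.σ ((n : 𝓞 F) : F) ≠ 0 := by simp
    refine lt_of_le_of_ne ?_ h0.symm
    nlinarith [sq_nonneg (S.σ τ), RingOfIntegers.coe_eq_algebraMap (n : 𝓞 F)]
  have hcoe : ∀ k : ℤ, (((S.ε ^ k : (𝓞 F)ˣ) : 𝓞 F) : F) = ((S.ε : 𝓞 F) : F) ^ k := fun k => by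
    have := map_zpow (Units.map (algebraMap (𝓞 F) F : 𝓞 F →* F)) S.ε k
    have := congrArg Units.val this
    rwa [Units.val_zpow_eq_zpow_val] at this
  have hε0 : ((S.ε : 𝓞 F) : F) ≠ 0 := by simp
  obtain ⟨k, rfl⟩ := S.unit_eq_zpow n hpos
  rw [hcoe] at *
  rcases Int.even_or_odd' k with ⟨l, rfl | rfl⟩
  · refine absurd ?_ (S.sq_ne_two ((τ : F) / ((S.ε : 𝓞 F) : F) ^ l))
    rw [div_pow, hτn, ← zpow_natCast, ← zpow_mul, mul_comm l]
    field_simp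
    simp
  · have h' : ((S.ε : 𝓞 F) : F) ^ (2 * l + 1) =
        (((S.ε : 𝓞 F) : F) ^ l) ^ 2 * ((S.ε : 𝓞 F) : F) := by
      rw [zpow_add_one₀ hε0, ← zpow_natCast, ← zpow_mul, mul_comm l]; rfl
    refine ⟨τ, l, by rw [hτn, h', mul_assoc], ?_⟩
    rw [hq, h', Algebra.algebraMap_eq_smul_one]

end FourthRoot

section Anticommute

variable {K H : Type} [Field K] [Ring H] [Algebra K H]

theorem smul_mul_smul_of_quadratic {x : H} {τ n : K} (h : x * x = τ • x - n • (1 : H)) (c : K) :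
    (c • x) * (c • x) = (c * τ) • (c • x) - (c ^ 2 * n) • (1 : H) := by
  rw [smul_mul_smul_comm, h]
  module

theorem anticomm_of_conj [CharZero K] {w x y : H} {ν : K} (hw : w * w = -1) (hxy : x * y = 1)
    (hyx : y * x = 1) (hns : ∀ a : K, algebraMap K H a ≠ w)
    (h : x * (1 + w) * y * (1 + w) = ν • (1 : H)) : x * w = -(w * x) := by
  have hw2 : (1 + w) * (1 - w) = (2 : K) • (1 : H) := by
    rw [mul_sub, add_mul _ _ w, hw, two_smul]
    simp only [one_mul, mul_one]
    abel
  obtain ⟨μ, rfl⟩ : ∃ μ, ν = 2 * μ := ⟨ν / 2, by ring⟩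
  have h1 : x * w * y = (μ - 1) • (1 : H) - μ • w := by
    have h2 : (2 : K) • (x * (1 + w) * y) = (2 * μ) • (1 - w) := by
      calc (2 : K) • (x * (1 + w) * y) = x * (1 + w) * y * ((1 + w) * (1 - w)) := by
            rw [hw2, mul_smul_comm, mul_one]
        _ = _ := by rw [← mul_assoc, h, smul_mul_assoc, one_mul]
    have h3 : x * (1 + w) * y = μ • (1 - w) := by
      rw [mul_smul] at h2
      exact smul_right_injective H (two_ne_zero (α := K)) h2
    rw [mul_add, mul_one, add_mul, hxy] at h3
    rw [eq_sub_of_add_eq' h3]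
    module
  have h4 : (-1 : H) = x * w * y * (x * w * y) := by
    have : x * w * y * (x * w * y) = x * (w * (y * x) * w) * y := by simp only [mul_assoc]
    rw [this, hyx, mul_one, hw, mul_neg_one, neg_mul, hxy]
  have h5 : (2 * μ * (μ - 1)) • w = ((μ - 1) ^ 2 - μ ^ 2 + 1) • (1 : H) := by
    rw [h1] at h4
    simp only [sub_mul, mul_sub, smul_mul_smul_comm, hw, mul_one, one_mul] at h4
    linear_combination (norm := module) h4
  have h6 : 2 * μ * (μ - 1) = 0 := by
    by_contra hne
    refine hns ((2 * μ * (μ - 1))⁻¹ * ((μ - 1) ^ 2 - μ ^ 2 + 1)) ?_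
    rw [Algebra.algebraMap_eq_smul_one, mul_smul, ← h5, smul_smul, inv_mul_cancel₀ hne, one_smul]
  have h7 : x * w = x * w * y * x := by rw [mul_assoc, hyx, mul_one]
  rcases mul_eq_zero.mp h6 with h8 | h8
  · obtain rfl : μ = 0 := by simpa using h8
    refine absurd ?_ (hns (-1))
    calc algebraMap K H (-1) = y * (x * w * y) * x := by
          rw [h1, Algebra.algebraMap_eq_smul_one]
          simp [hyx]
      _ = (y * x) * w * (y * x) := by simp only [mul_assoc]
      _ = w := by rw [hyx, one_mul, mul_one]
  · obtain rfl : μ = 1 := sub_eq_zero.mp h8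
    rw [h7, h1]
    simp

theorem trace_eq_zero_of_anticomm [CharZero K] [Nontrivial H] {w x y : H} {τ n : K}
    (hw : w * w = -1)
    (hxy : x * y = 1) (hx : x * x = τ • x - n • (1 : H)) (h : x * w = -(w * x)) : τ = 0 := by
  have h1 : w * (x * x) = x * x * w := by
    rw [mul_assoc, h, mul_neg, ← mul_assoc x, h, neg_mul, neg_neg, mul_assoc]
  rw [hx, mul_sub, sub_mul, mul_smul_comm, smul_mul_assoc, h, mul_smul_comm, smul_mul_assoc,
    mul_one, one_mul] at h1
  have h2 : (2 * τ) • (w * x) = 0 := by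
    have := sub_left_inj.mp h1
    rw [mul_smul, two_smul]
    nth_rewrite 1 [this]
    simp
  have h3 : (2 * τ) • (1 : H) = 0 := by
    calc (2 * τ) • (1 : H) = -(w * ((2 * τ) • (w * x)) * y) := by
          rw [mul_smul_comm, smul_mul_assoc, ← mul_assoc, hw, mul_assoc, hxy]
          simp
      _ = 0 := by rw [h2]; simp
  simpa using h3

theorem not_scalar_of_anticomm [CharZero K] [Nontrivial H] {w x y : H} (hw : w * w = -1)
    (hxy : x * y = 1) (h : x * w = -(w * x)) (a : K) : algebraMap K H a ≠ x := by
  rintro rfl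
  rw [Algebra.commutes, eq_neg_iff_add_eq_zero, ← two_smul K] at h
  have h1 : w * algebraMap K H a = 0 := by simpa using h
  have h2 : (1 : H) = -(w * (w * algebraMap K H a) * y) := by
    rw [← mul_assoc, hw, mul_assoc, hxy]; simp
  rw [h1] at h2
  simp at h2

end Anticommute

section StandardPair

variable {F}
variable {H : Type} [Ring H] [Algebra F H] {O : Subring H}

theorem RealQuadratic.coe_zpow (S : RealQuadratic F) (k : ℤ) :
    (((S.ε ^ k : (𝓞 F)ˣ) : 𝓞 F) : F) = ((S.ε : 𝓞 F) : F) ^ k := by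
  have := congrArg Units.val
    (map_zpow (Units.map (algebraMap (𝓞 F) F : 𝓞 F →* F)) S.ε k)
  rwa [Units.val_zpow_eq_zpow_val] at this

theorem RealQuadratic.exists_sqrt_two_mul [Nontrivial H] (hO : IsOrder F O) (hH : IsQuatAlg F H)
    (S : RealQuadratic F) (u : (↥O)ˣ) (h2 : ¬ IsScalarUnit F (u ^ 2))
    (h4 : IsScalarUnit F (u ^ 4)) : ∃ t : 𝓞 F, t ^ 2 = 2 * (S.ε : 𝓞 F) := by
  obtain ⟨τ, l, h, -⟩ := hO.exists_trace_sq hH S u h2 h4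
  have hε0 : ((S.ε : 𝓞 F) : F) ≠ 0 := by simp
  refine ⟨τ * (S.ε ^ (-l) : (𝓞 F)ˣ), RingOfIntegers.ext ?_⟩
  rw [RingOfIntegers.coe_eq_algebraMap, map_pow, map_mul, ← RingOfIntegers.coe_eq_algebraMap,
    ← RingOfIntegers.coe_eq_algebraMap, S.coe_zpow, mul_pow, h, zpow_neg]
  have := zpow_ne_zero l hε0
  have h2' : ((2 * (S.ε : 𝓞 F) : 𝓞 F) : F) = 2 * ((S.ε : 𝓞 F) : F) := by
    rw [RingOfIntegers.coe_eq_algebraMap, map_mul, map_ofNat]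
  rw [h2']
  field_simp

theorem Ramified.coe_t_sq (S : Ramified F) : (S.t : F) ^ 2 = 2 * ((S.ε : 𝓞 F) : F) := by
  have := congrArg (algebraMap (𝓞 F) F) S.t_sq
  rwa [map_pow, map_mul, map_ofNat] at this

theorem Ramified.exists_order_eight [Nontrivial H] (hO : IsOrder F O) (hH : IsQuatAlg F H)
    (S : Ramified F) (u : (↥O)ˣ) (h2 : ¬ IsScalarUnit F (u ^ 2))
    (h4 : IsScalarUnit F (u ^ 4)) : ∃ (c : 𝓞 F) (w : H), c ≠ 0 ∧ w * w = -1 ∧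
      (S.t : F) • ((c : F) • ((u : O) : H)) = 1 + w := by
  obtain ⟨τ, l, h, hq⟩ := hO.exists_trace_sq hH S.toRealQuadratic u h2 h4
  have hε0 : ((S.ε : 𝓞 F) : F) ≠ 0 := by simp
  have hεl := zpow_ne_zero l hε0
  have ht := S.coe_t_sq
  obtain ⟨s, hs, hτ⟩ : ∃ s : 𝓞 F, (s : F) ^ 2 = 1 ∧
      (τ : F) = (s : F) * (((S.ε : 𝓞 F) : F) ^ l * (S.t : F)) := by
    have : (τ : F) ^ 2 = (((S.ε : 𝓞 F) : F) ^ l * (S.t : F)) ^ 2 := by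
      rw [h, mul_pow, ht]; ring
    rcases sq_eq_sq_iff_eq_or_eq_neg.mp this with h | h
    · exact ⟨1, by simp, by rw [h]; simp⟩
    · exact ⟨-1, by simp, by rw [h]; simp⟩
  have hc : ((s * (S.ε ^ (-(l + 1)) : (𝓞 F)ˣ) : 𝓞 F) : F) =
      (s : F) * (((S.ε : 𝓞 F) : F) ^ l * ((S.ε : 𝓞 F) : F))⁻¹ := by
    rw [RingOfIntegers.coe_eq_algebraMap, map_mul, ← RingOfIntegers.coe_eq_algebraMap,
      ← RingOfIntegers.coe_eq_algebraMap, S.coe_zpow, zpow_neg, zpow_add_one₀ hε0]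
  set c : 𝓞 F := s * (S.ε ^ (-(l + 1)) : (𝓞 F)ˣ)
  have hs0 : (s : F) ≠ 0 := by
    intro h0; rw [h0] at hs; simp at hs
  have hc0 : (c : F) ≠ 0 := by
    rw [hc]
    exact mul_ne_zero hs0 (inv_ne_zero (mul_ne_zero hεl hε0))
  refine ⟨c, (S.t : F) • ((c : F) • ((u : O) : H)) - 1, fun h => hc0 (by rw [h]; simp), ?_,
    by abel⟩
  generalize (S.t : F) = t at *
  generalize ((S.ε : 𝓞 F) : F) = ε at *
  generalize (c : F) = c' at *
  generalize (τ : F) = τ' at *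
  generalize (s : F) = s' at *
  generalize ((u : O) : H) = x at *
  have e1 : t * c' * τ' = 2 := by
    rw [hc, hτ]
    field_simp
    linear_combination s' ^ 2 * ht + 2 * ε * hs
  have e2 : (t * c') ^ 2 * ((ε ^ l) ^ 2 * ε) = 2 := by
    rw [hc]
    field_simp
    linear_combination s' ^ 2 * ht + 2 * ε * hs
  have hX := smul_mul_smul_of_quadratic hq (t * c')
  rw [e1, e2] at hX
  rw [smul_smul, sub_mul, mul_sub, hX, mul_one, one_mul]
  module

theorem Ramified.exists_standard_pair [Nontrivial H] (hO : IsOrder F O) (hH : IsQuatAlg F H)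
    (hdef : TotallyDefinite F H) (S : Ramified F) (u v : (↥O)ˣ) (h2 : ¬ IsScalarUnit F (u ^ 2))
    (h4 : IsScalarUnit F (u ^ 4)) (huv : IsScalarUnit F (v * u * v⁻¹ * u)) :
    ∃ w j : H, w * w = -1 ∧ j * j = -1 ∧ j * w = -(w * j) ∧ j ∈ O ∧
      (S.t : F)⁻¹ • (1 + w) ∈ O := by
  obtain ⟨c, w, hc, hw, hcw⟩ := S.exists_order_eight hO hH u h2 h4
  have ht0 : (S.t : F) ≠ 0 := by simpa using S.t_ne_zero
  have hε0 : ((S.ε : 𝓞 F) : F) ≠ 0 := by simp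
  have hα : (S.t : F)⁻¹ • (1 + w) ∈ O := by
    rw [← hcw, inv_smul_smul₀ ht0]
    exact hO.smul_mem c (u : O).2
  have hvv := coe_mul_inv v
  have hvv' := coe_inv_mul v
  have hns : ∀ a : F, algebraMap F H a ≠ w := fun a ha => h2 (by
    refine hO.isScalarUnit _ (a := (((c : F))⁻¹ * ((S.t : F)⁻¹ * (1 + a))) ^ 2) ?_
    have hu : ((u : O) : H) = algebraMap F H ((c : F)⁻¹ * ((S.t : F)⁻¹ * (1 + a))) := by
      have hc0 : (c : F) ≠ 0 := by simpa using hc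
      rw [map_mul, map_mul, map_add, map_one, ha, ← hcw, ← Algebra.smul_def, ← Algebra.smul_def,
        inv_smul_smul₀ ht0, inv_smul_smul₀ hc0]
    rw [map_pow, ← hu]
    rfl)
  obtain ⟨r, hr⟩ := huv
  have hr' : ((v : O) : H) * (u : O) * ((v⁻¹ : (↥O)ˣ) : O) * (u : O) =
    algebraMap F H (algebraMap (𝓞 F) F r) := hr
  have hanti : ((v : O) : H) * w = -(w * (v : O)) := by
    refine anticomm_of_conj hw hvv hvv' hns
      (ν := ((S.t : F) * c) ^ 2 * algebraMap (𝓞 F) F r) ?_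
    have hz : ∀ z : F, ((v : O) : H) * (z • ((u : O) : H)) * ((v⁻¹ : (↥O)ˣ) : O) *
        (z • ((u : O) : H)) = (z ^ 2 * algebraMap (𝓞 F) F r) • (1 : H) := fun z => by
      simp only [mul_smul_comm, smul_mul_assoc]
      rw [hr', smul_smul, Algebra.algebraMap_eq_smul_one,
        smul_smul, pow_two]
    rw [← hcw, smul_smul, hz]
  have hvns := not_scalar_of_anticomm (K := F) hw hvv hanti
  obtain ⟨τ, m, hq⟩ := hO.exists_quadratic_unit hH v hvns
  rw [Algebra.algebraMap_eq_smul_one] at hq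
  have hτ := trace_eq_zero_of_anticomm hw hvv hq hanti
  rw [hτ, zero_smul, zero_sub] at hq
  have hpos : 0 < S.σ (algebraMap (𝓞 F) F m) := by
    have := hdef.sq_neg S.σ hvns (r := -((m : 𝓞 F) : F)) (by
      rw [hq, map_neg, Algebra.algebraMap_eq_smul_one])
    rw [map_neg] at this
    exact neg_lt_zero.mp this
  obtain ⟨k, rfl⟩ := S.unit_eq_zpow m hpos
  rw [S.coe_zpow] at hq
  have hmem : ∀ l : ℤ, ∀ x ∈ O, (((S.ε : 𝓞 F) : F) ^ l)⁻¹ • x ∈ O := fun l x hx => by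
    rw [← zpow_neg, ← S.coe_zpow]
    exact hO.smul_mem _ hx
  rcases Int.even_or_odd' k with ⟨l, rfl | rfl⟩
  · refine ⟨w, (((S.ε : 𝓞 F) : F) ^ l)⁻¹ • (v : O), hw, ?_, ?_, hmem _ _ (v : O).2, hα⟩
    · have hl := zpow_ne_zero l hε0
      rw [smul_mul_smul_comm, hq, smul_neg, smul_smul, two_mul, zpow_add₀ hε0]
      rw [show (((S.ε : 𝓞 F) : F) ^ l)⁻¹ * (((S.ε : 𝓞 F) : F) ^ l)⁻¹ *
        (((S.ε : 𝓞 F) : F) ^ l * ((S.ε : 𝓞 F) : F) ^ l) = 1 by field_simp, one_smul]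
    · rw [smul_mul_assoc, hanti, mul_smul_comm, smul_neg]
  · refine ⟨w, (((S.ε : 𝓞 F) : F) ^ l)⁻¹ • ((S.t : F)⁻¹ • (1 + w) * (v : O)), hw, ?_, ?_,
      hmem _ _ (O.mul_mem hα (v : O).2), hα⟩
    · have h1 : (1 + w) * (v : O) * ((1 + w) * (v : O)) =
          (-2 * ((S.ε : 𝓞 F) : F) ^ (2 * l + 1)) • (1 : H) := by
        have h3 : ((v : O) : H) * (1 + w) = (1 - w) * (v : O) := by
          rw [mul_add, hanti, sub_mul, mul_one, one_mul, sub_eq_add_neg]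
        have h4 : (1 + w) * (1 - w) = (2 : F) • (1 : H) := by
          rw [mul_sub, add_mul _ _ w, hw, two_smul]
          simp only [one_mul, mul_one]
          abel
        rw [mul_assoc, ← mul_assoc ((v : O) : H), h3, mul_assoc, hq, ← mul_assoc, h4]
        simp only [mul_smul_comm, mul_one, smul_smul, ← neg_smul]
        congr 1
        ring
      have hl := zpow_ne_zero l hε0
      rw [smul_mul_assoc (S.t : F)⁻¹, smul_smul, smul_mul_smul_comm, h1, smul_smul]
      refine Eq.trans (b := (-1 : F) • (1 : H)) ?_ (by rw [neg_one_smul])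
      congr 1
      rw [two_mul, zpow_add_one₀ hε0, zpow_add₀ hε0]
      field_simp
      rw [S.coe_t_sq]
    · rw [smul_mul_assoc, mul_smul_comm, ← smul_neg]
      congr 1
      rw [smul_mul_assoc, smul_mul_assoc, mul_smul_comm, ← smul_neg, mul_assoc, hanti]
      congr 1
      simp only [add_mul, mul_add, mul_neg, one_mul, ← mul_assoc]

end StandardPair

section Norm

variable {K : Type} [Field K]

/-- The reduced norm of the quaternion algebra `(-1, -1 / K)`. -/
def nrd (q : ℍ[K,-1,-1]) : K := q.re ^ 2 + q.imI ^ 2 + q.imJ ^ 2 + q.imK ^ 2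

theorem nrd_mul (p q : ℍ[K,-1,-1]) : nrd (p * q) = nrd p * nrd q := by
  simp [nrd]; ring

theorem mul_star_eq (q : ℍ[K,-1,-1]) : q * star q = algebraMap K _ (nrd q) := by
  ext <;> simp [nrd, QuaternionAlgebra.algebraMap_eq] <;> ring

theorem star_mul_eq (q : ℍ[K,-1,-1]) : star q * q = algebraMap K _ (nrd q) := by
  ext <;> simp [nrd, QuaternionAlgebra.algebraMap_eq] <;> ring

theorem nrd_pos (σ : K →+* ℝ) {q : ℍ[K,-1,-1]} (hq : q ≠ 0) : 0 < σ (nrd q) := by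
  have hσ : ∀ x : K, x ≠ 0 → 0 < σ x ^ 2 := fun x hx =>
    sq_pos_of_ne_zero (by simpa using hx)
  have h0 : ∀ x : K, 0 ≤ σ x ^ 2 := fun x => sq_nonneg _
  have : q.re ≠ 0 ∨ q.imI ≠ 0 ∨ q.imJ ≠ 0 ∨ q.imK ≠ 0 := by
    by_contra! h
    exact hq (by ext <;> simp [h])
  have a := h0 q.re; have b := h0 q.imI; have c := h0 q.imJ; have d := h0 q.imK
  simp only [nrd, map_add, map_pow]
  rcases this with h | h | h | h <;> have := hσ _ h <;> linarith

theorem nrd_ne_zero (σ : K →+* ℝ) {q : ℍ[K,-1,-1]} (hq : q ≠ 0) : nrd q ≠ 0 := fun h => by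
  have := nrd_pos σ hq
  rw [h, map_zero] at this
  exact this.false

theorem isUnit_of_ne_zero (σ : K →+* ℝ) {q : ℍ[K,-1,-1]} (hq : q ≠ 0) : IsUnit q := by
  have h := nrd_ne_zero σ hq
  refine ⟨⟨q, (nrd q)⁻¹ • star q, ?_, ?_⟩, rfl⟩
  · rw [mul_smul_comm, mul_star_eq, Algebra.algebraMap_eq_smul_one, smul_smul,
      inv_mul_cancel₀ h, one_smul]
  · rw [smul_mul_assoc, star_mul_eq, Algebra.algebraMap_eq_smul_one, smul_smul,
      inv_mul_cancel₀ h, one_smul]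

theorem exists_algEquiv {H : Type} [Ring H] [Algebra K H] (hH : IsQuatAlg K H) (σ : K →+* ℝ)
    {w j : H} (hw : w * w = -1) (hj : j * j = -1) (hjw : j * w = -(w * j)) :
    ∃ e : ℍ[K,-1,-1] ≃ₐ[K] H, e ⟨0, 1, 0, 0⟩ = w ∧ e ⟨0, 0, 1, 0⟩ = j := by
  have := hH.nontrivial
  let B : QuaternionAlgebra.Basis H (-1 : K) 0 (-1) :=
    { i := w, j := j, k := w * j
      i_mul_i := by simp [hw]
      j_mul_j := by simp [hj]
      i_mul_j := rfl
      j_mul_i := by simp [hjw] }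
  have hinj : Function.Injective B.liftHom.toLinearMap := by
    rw [← LinearMap.ker_eq_bot, LinearMap.ker_eq_bot']
    intro q hq
    by_contra hne
    have h1 : B.liftHom (q * star q) = 0 := by
      rw [map_mul]
      have : B.liftHom q = 0 := hq
      rw [this, zero_mul]
    rw [mul_star_eq, AlgHom.commutes] at h1
    exact nrd_ne_zero σ hne (by simpa using h1)
  have hfd : FiniteDimensional K H := .of_finrank_pos (by rw [hH.finrank_eq_four]; norm_num)
  have hsurj : Function.Surjective B.liftHom.toLinearMap :=
    (LinearMap.injective_iff_surjective_of_finrank_eq_finrank (by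
      rw [hH.finrank_eq_four, QuaternionAlgebra.finrank_eq_four])).mp hinj
  refine ⟨AlgEquiv.ofBijective B.liftHom ⟨hinj, hsurj⟩, ?_, ?_⟩
  · change B.lift _ = _
    simp [B, QuaternionAlgebra.Basis.lift]
  · change B.lift _ = _
    simp [B, QuaternionAlgebra.Basis.lift]

end Norm

section StandardEquiv

variable {F}
variable {H : Type} [Ring H] [Algebra F H] {O : Subring H} {G : Type*} [Group G]

/-- The unit `(1 + i) / t` of reduced norm `ε⁻¹`. -/
def Ramified.α (S : Ramified F) : ℍ[F,-1,-1] := ⟨(S.t : F)⁻¹, (S.t : F)⁻¹, 0, 0⟩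

theorem RedUnitIso.exists_sqrt (hO : IsOrder F O) (hH : IsQuatAlg F H) (S : RealQuadratic F)
    (hG : RedUnitIso F O G) {r : G} (h4 : r ^ 4 = 1) (h2 : r ^ 2 ≠ 1) :
    ∃ t : 𝓞 F, t ^ 2 = 2 * (S.ε : 𝓞 F) := by
  have := hH.nontrivial
  obtain ⟨φ, hφ, hker⟩ := hG
  obtain ⟨u, rfl⟩ := hφ r
  exact S.exists_sqrt_two_mul hO hH u (by rwa [← hker, map_pow]) (by rwa [← hker, map_pow])

theorem RedUnitIso.exists_standard_equiv (hO : IsOrder F O) (hH : IsQuatAlg F H)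
    (hdef : TotallyDefinite F H) (S : Ramified F) (hG : RedUnitIso F O G) {r s : G}
    (h4 : r ^ 4 = 1) (h2 : r ^ 2 ≠ 1) (hrs : s * r * s⁻¹ * r = 1) :
    ∃ e : ℍ[F,-1,-1] ≃ₐ[F] H, e S.α ∈ O ∧ e ⟨0, 0, 1, 0⟩ ∈ O := by
  have := hH.nontrivial
  obtain ⟨φ, hφ, hker⟩ := hG
  obtain ⟨u, rfl⟩ := hφ r
  obtain ⟨v, rfl⟩ := hφ s
  obtain ⟨w, j, hw, hj, hjw, hjO, hwO⟩ := S.exists_standard_pair hO hH hdef u v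
    (by rwa [← hker, map_pow]) (by rwa [← hker, map_pow])
    (by rw [← hker]; simpa using hrs)
  obtain ⟨e, ei, ej⟩ := exists_algEquiv hH S.σ hw hj hjw
  refine ⟨e, ?_, by rwa [ej]⟩
  have : S.α = (S.t : F)⁻¹ • (1 + ⟨0, 1, 0, 0⟩) := by
    ext <;> simp [Ramified.α]
  rwa [this, map_smul, map_add, map_one, ei]

end StandardEquiv

section Lattice

variable {F}
variable {A : Type} [Ring A] [Algebra F A] {b₁ b₂ b₃ b₄ : A}

variable (F) in
/-- The lattice with the given basis over the ring of integers. -/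
def lattice (b₁ b₂ b₃ b₄ : A) : AddSubgroup A where
  carrier := {x | ∃ c₁ c₂ c₃ c₄ : 𝓞 F, x = algebraMap (𝓞 F) F c₁ • b₁ +
    algebraMap (𝓞 F) F c₂ • b₂ + algebraMap (𝓞 F) F c₃ • b₃ + algebraMap (𝓞 F) F c₄ • b₄}
  zero_mem' := ⟨0, 0, 0, 0, by simp⟩
  add_mem' := by
    rintro _ _ ⟨c₁, c₂, c₃, c₄, rfl⟩ ⟨d₁, d₂, d₃, d₄, rfl⟩
    refine ⟨c₁ + d₁, c₂ + d₂, c₃ + d₃, c₄ + d₄, ?_⟩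
    simp only [map_add, add_smul]
    abel
  neg_mem' := by
    rintro _ ⟨c₁, c₂, c₃, c₄, rfl⟩
    refine ⟨-c₁, -c₂, -c₃, -c₄, ?_⟩
    simp only [map_neg, neg_smul]
    abel

theorem smul_mem_lattice (r : 𝓞 F) {x : A} (hx : x ∈ lattice F b₁ b₂ b₃ b₄) :
    algebraMap (𝓞 F) F r • x ∈ lattice F b₁ b₂ b₃ b₄ := by
  obtain ⟨c₁, c₂, c₃, c₄, rfl⟩ := hx
  exact ⟨r * c₁, r * c₂, r * c₃, r * c₄, by simp only [map_mul, mul_smul, smul_add]⟩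

theorem mul_mem_lattice {x : A} (h₁ : b₁ * x ∈ lattice F b₁ b₂ b₃ b₄)
    (h₂ : b₂ * x ∈ lattice F b₁ b₂ b₃ b₄) (h₃ : b₃ * x ∈ lattice F b₁ b₂ b₃ b₄)
    (h₄ : b₄ * x ∈ lattice F b₁ b₂ b₃ b₄) {y : A} (hy : y ∈ lattice F b₁ b₂ b₃ b₄) :
    y * x ∈ lattice F b₁ b₂ b₃ b₄ := by
  obtain ⟨c₁, c₂, c₃, c₄, rfl⟩ := hy
  simp only [add_mul, smul_mul_assoc]
  exact add_mem (add_mem (add_mem (smul_mem_lattice _ h₁) (smul_mem_lattice _ h₂))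
    (smul_mem_lattice _ h₃)) (smul_mem_lattice _ h₄)

theorem mul_mem_lattice_of_basis
    (h₁ : ∀ y ∈ lattice F b₁ b₂ b₃ b₄, y * b₁ ∈ lattice F b₁ b₂ b₃ b₄)
    (h₂ : ∀ y ∈ lattice F b₁ b₂ b₃ b₄, y * b₂ ∈ lattice F b₁ b₂ b₃ b₄)
    (h₃ : ∀ y ∈ lattice F b₁ b₂ b₃ b₄, y * b₃ ∈ lattice F b₁ b₂ b₃ b₄)
    (h₄ : ∀ y ∈ lattice F b₁ b₂ b₃ b₄, y * b₄ ∈ lattice F b₁ b₂ b₃ b₄) (y x : A)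
    (hy : y ∈ lattice F b₁ b₂ b₃ b₄) (hx : x ∈ lattice F b₁ b₂ b₃ b₄) :
    y * x ∈ lattice F b₁ b₂ b₃ b₄ := by
  obtain ⟨c₁, c₂, c₃, c₄, rfl⟩ := hx
  simp only [mul_add, mul_smul_comm]
  exact add_mem (add_mem (add_mem (smul_mem_lattice _ (h₁ y hy)) (smul_mem_lattice _ (h₂ y hy)))
    (smul_mem_lattice _ (h₃ y hy))) (smul_mem_lattice _ (h₄ y hy))

theorem range_smul_fg (b : A) : ((AddMonoidHom.flip (smulAddHom F A) b).comp
    (algebraMap (𝓞 F) F).toAddMonoidHom).range.FG := by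
  have htop : AddGroup.FG (𝓞 F) :=
    Module.Finite.iff_addGroup_fg.mp (inferInstance : Module.Finite ℤ (𝓞 F))
  exact (AddGroup.fg_iff_addSubgroup_fg _).mp (AddGroup.fg_range _)

theorem lattice_fg : (lattice F b₁ b₂ b₃ b₄).FG := by
  have hf : lattice F b₁ b₂ b₃ b₄ =
      (((AddMonoidHom.flip (smulAddHom F A) b₁).comp (algebraMap (𝓞 F) F).toAddMonoidHom).range ⊔
      ((AddMonoidHom.flip (smulAddHom F A) b₂).comp (algebraMap (𝓞 F) F).toAddMonoidHom).range) ⊔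
      (((AddMonoidHom.flip (smulAddHom F A) b₃).comp (algebraMap (𝓞 F) F).toAddMonoidHom).range ⊔
      ((AddMonoidHom.flip (smulAddHom F A) b₄).comp (algebraMap (𝓞 F) F).toAddMonoidHom).range) :=
    by
    ext x
    simp only [AddSubgroup.mem_sup, AddMonoidHom.mem_range]
    constructor
    · rintro ⟨c₁, c₂, c₃, c₄, rfl⟩
      exact ⟨_, ⟨_, ⟨c₁, rfl⟩, _, ⟨c₂, rfl⟩, rfl⟩, _, ⟨_, ⟨c₃, rfl⟩, _, ⟨c₄, rfl⟩, rfl⟩,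
        (add_assoc _ _ _).symm⟩
    · rintro ⟨_, ⟨_, ⟨c₁, rfl⟩, _, ⟨c₂, rfl⟩, rfl⟩, _, ⟨_, ⟨c₃, rfl⟩, _, ⟨c₄, rfl⟩, rfl⟩, rfl⟩
      exact ⟨c₁, c₂, c₃, c₄, (add_assoc _ _ _).symm⟩
  rw [hf]
  exact ((range_smul_fg _).sup (range_smul_fg _)).sup ((range_smul_fg _).sup (range_smul_fg _))

/-- A lattice closed under multiplication as a subring. -/
def latticeRing (L : AddSubgroup A) (h1 : (1 : A) ∈ L) (hmul : ∀ x y, x ∈ L → y ∈ L → x * y ∈ L) :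
    Subring A where
  __ := L
  one_mem' := h1
  mul_mem' := fun hx hy => hmul _ _ hx hy

end Lattice

namespace Ramified

variable {F}

theorem isOrder_latticeRing (S : Ramified F) {b₁ b₂ b₃ b₄ : ℍ[F,-1,-1]}
    (h1 : (1 : ℍ[F,-1,-1]) ∈ lattice F b₁ b₂ b₃ b₄)
    (hmul : ∀ x y, x ∈ lattice F b₁ b₂ b₃ b₄ → y ∈ lattice F b₁ b₂ b₃ b₄ →
      x * y ∈ lattice F b₁ b₂ b₃ b₄) (hα : S.α ∈ lattice F b₁ b₂ b₃ b₄)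
    (hj : (⟨0, 0, 1, 0⟩ : ℍ[F,-1,-1]) ∈ lattice F b₁ b₂ b₃ b₄) :
    IsOrder F (latticeRing (lattice F b₁ b₂ b₃ b₄) h1 hmul) := by
  refine ⟨?_, lattice_fg, ?_⟩
  · rintro _ ⟨r, rfl⟩
    have := smul_mem_lattice r h1
    rwa [← Algebra.algebraMap_eq_smul_one] at this
  · have ht0 : (S.t : F) ≠ 0 := by simpa using S.t_ne_zero
    rw [eq_top_iff]
    rintro q -
    set V := Submodule.span F
      ((latticeRing (lattice F b₁ b₂ b₃ b₄) h1 hmul : Subring ℍ[F,-1,-1]) : Set ℍ[F,-1,-1])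
    have hV : ∀ x ∈ lattice F b₁ b₂ b₃ b₄, x ∈ V := fun x hx => Submodule.subset_span hx
    have hq : q = (q.re - q.imI) • 1 + (q.imI * S.t) • S.α +
        (q.imJ - q.imK) • (⟨0, 0, 1, 0⟩ : ℍ[F,-1,-1]) +
        (q.imK * S.t) • (S.α * (⟨0, 0, 1, 0⟩ : ℍ[F,-1,-1])) := by
      ext <;> simp [Ramified.α] <;> field_simp <;> ring
    rw [hq]
    exact V.add_mem (V.add_mem (V.add_mem (V.smul_mem _ (hV _ h1)) (V.smul_mem _ (hV _ hα)))
      (V.smul_mem _ (hV _ hj))) (V.smul_mem _ (hV _ (hmul _ _ hα hj)))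

end Ramified

namespace Ramified

variable {F}

theorem coe_ofNat (n : ℕ) [n.AtLeastTwo] :
    ((OfNat.ofNat n : 𝓞 F) : F) = OfNat.ofNat n := map_ofNat (algebraMap (𝓞 F) F) n

theorem coe_t_ne_zero (S : Ramified F) : (S.t : F) ≠ 0 := by simpa using S.t_ne_zero

theorem coe_ε (S : Ramified F) : ((S.ε : 𝓞 F) : F) = (S.t : F) ^ 2 / 2 := by
  rw [S.coe_t_sq]; ring

theorem coe_δ (S : Ramified F) : (S.δ : F) = 2 / (S.t : F) ^ 2 := by
  have h := congrArg (algebraMap (𝓞 F) F) S.two_eq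
  rw [map_mul, map_mul, map_ofNat] at h
  have ht := S.coe_t_ne_zero
  rw [h]; field_simp

theorem coe_η (S : Ramified F) : (S.η : F) = S.t / 2 - 1 / S.t := by
  have h := congrArg (algebraMap (𝓞 F) F) S.ε_eq
  rw [map_add, map_mul, map_one, show algebraMap (𝓞 F) F S.ε = _ from S.coe_ε] at h
  have ht := S.coe_t_ne_zero
  field_simp
  linear_combination -2 * h

theorem coe_θ (S : Ramified F) :
    (S.θ : F) = ((S.t / 2 - 1 / S.t) ^ 2 - (S.t / 2 - 1 / S.t)) / S.t := by
  have h := congrArg (algebraMap (𝓞 F) F) S.η_sq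
  rw [map_mul, map_add, map_mul] at h
  have ht := S.coe_t_ne_zero
  rw [← S.coe_η, eq_div_iff ht]
  linear_combination -h

/-- An integral basis of the maximal order with reduced unit group `S₄`. -/
def basisS (S : Ramified F) : Fin 4 → ℍ[F,-1,-1] :=
  ![⟨1 / 2, 1 / 2, 1 / 2, 1 / 2⟩, ⟨0, S.t / 2, 0, S.t / 2⟩, ⟨0, 0, S.t / 2, S.t / 2⟩,
    ⟨0, 0, 0, S.t ^ 2 / 2⟩]

/-- An integral basis of the maximal order with reduced unit group `D₄`. -/
def basisD (S : Ramified F) : Fin 4 → ℍ[F,-1,-1] :=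
  ![⟨S.η / 2, (S.η + S.t) / 2, (1 + S.η) / 2, (1 + S.η) / 2⟩,
    ⟨(1 + S.η) / 2, (1 + S.η) / 2, S.η / 2, (S.η + S.t) / 2⟩,
    ⟨S.t / 2, S.t / 2, 0, 0⟩, ⟨0, 0, S.t / 2, S.t / 2⟩]

def latticeS (S : Ramified F) : AddSubgroup ℍ[F,-1,-1] :=
  lattice F (S.basisS 0) (S.basisS 1) (S.basisS 2) (S.basisS 3)

def latticeD (S : Ramified F) : AddSubgroup ℍ[F,-1,-1] :=
  lattice F (S.basisD 0) (S.basisD 1) (S.basisD 2) (S.basisD 3)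

theorem mem_latticeS (S : Ramified F) {x : ℍ[F,-1,-1]} : x ∈ S.latticeS ↔ ∃ A E p q : 𝓞 F,
    x.re = (A : F) / 2 ∧ x.imI = ((A : F) + S.t * E) / 2 ∧ x.imJ = ((A : F) + S.t * p) / 2 ∧
      x.imK = ((A : F) + S.t * p + S.t * E + S.t ^ 2 * q) / 2 := by
  constructor
  · rintro ⟨A, E, p, q, rfl⟩
    refine ⟨A, E, p, q, ?_, ?_, ?_, ?_⟩ <;> simp [basisS, -algebraMap_smul] <;> ring
  · rintro ⟨A, E, p, q, h1, h2, h3, h4⟩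
    refine ⟨A, E, p, q, ?_⟩
    ext <;> simp [basisS, -algebraMap_smul, *] <;> ring

theorem mem_latticeD (S : Ramified F) {x : ℍ[F,-1,-1]} : x ∈ S.latticeD ↔ ∃ E G p q : 𝓞 F,
    x.re = ((S.η : F) * E + (1 + S.η) * G + S.t * p) / 2 ∧
    x.imI = ((S.η : F) * E + (1 + S.η) * G + S.t * p + S.t * E) / 2 ∧
    x.imJ = ((S.η : F) * G + (1 + S.η) * E + S.t * q) / 2 ∧
    x.imK = ((S.η : F) * G + (1 + S.η) * E + S.t * q + S.t * G) / 2 := by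
  constructor
  · rintro ⟨E, G, p, q, rfl⟩
    refine ⟨E, G, p, q, ?_, ?_, ?_, ?_⟩ <;> simp [basisD, -algebraMap_smul] <;> ring
  · rintro ⟨E, G, p, q, h1, h2, h3, h4⟩
    refine ⟨E, G, p, q, ?_⟩
    ext <;> simp [basisD, -algebraMap_smul, *] <;> ring

theorem one_mem_latticeS (S : Ramified F) : 1 ∈ S.latticeS := by
  have ht := S.coe_t_ne_zero
  refine S.mem_latticeS.mpr ⟨2, 2 * S.η - S.t, 2 * S.η - S.t, S.δ, ?_, ?_, ?_, ?_⟩ <;>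
    simp [α, basisS, S.coe_δ, S.coe_ε, S.coe_η, S.coe_θ] <;>
    (repeat rw [coe_ofNat]) <;> (repeat rw [map_ofNat]) <;> field_simp <;> ring

theorem α_mem_latticeS (S : Ramified F) : S.α ∈ S.latticeS := by
  have ht := S.coe_t_ne_zero
  refine S.mem_latticeS.mpr ⟨-2 * S.η + S.t, 0, -S.δ, 0, ?_, ?_, ?_, ?_⟩ <;>
    simp [α, basisS, S.coe_δ, S.coe_ε, S.coe_η, S.coe_θ] <;>
    (repeat rw [coe_ofNat]) <;> (repeat rw [map_ofNat]) <;> field_simp <;> ring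

theorem j_mem_latticeS (S : Ramified F) : ⟨0, 0, 1, 0⟩ ∈ S.latticeS := by
  have ht := S.coe_t_ne_zero
  refine S.mem_latticeS.mpr ⟨0, 0, -2 * S.η + S.t, -S.δ, ?_, ?_, ?_, ?_⟩ <;>
    simp [α, basisS, S.coe_δ, S.coe_ε, S.coe_η, S.coe_θ] <;>
    (repeat rw [coe_ofNat]) <;> (repeat rw [map_ofNat]) <;> field_simp <;> ring

theorem basisS_mul_α (S : Ramified F) :
    S.basisS 0 * S.α ∈ S.latticeS ∧
    S.basisS 1 * S.α ∈ S.latticeS ∧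
    S.basisS 2 * S.α ∈ S.latticeS ∧
    S.basisS 3 * S.α ∈ S.latticeS := by
  have ht := S.coe_t_ne_zero
  refine ⟨?_, ?_, ?_, ?_⟩
  · refine S.mem_latticeS.mpr ⟨0, S.δ, S.δ, -4 * S.θ + 2 * S.δ + 4 * S.η - 2 - S.t, ?_, ?_, ?_,
      ?_⟩ <;>
      simp [α, basisS, S.coe_δ, S.coe_ε, S.coe_η, S.coe_θ] <;>
    (repeat rw [coe_ofNat]) <;> (repeat rw [map_ofNat]) <;> field_simp <;> ring
  · refine S.mem_latticeS.mpr ⟨-1, -2 * S.η + S.t, -2 * S.η + S.t, -S.δ, ?_, ?_, ?_, ?_⟩ <;>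
      simp [α, basisS, S.coe_δ, S.coe_ε, S.coe_η, S.coe_θ] <;>
    (repeat rw [coe_ofNat]) <;> (repeat rw [map_ofNat]) <;> field_simp <;> ring
  · refine S.mem_latticeS.mpr ⟨0, 0, -2 * S.η + S.t, -S.δ, ?_, ?_, ?_, ?_⟩ <;>
      simp [α, basisS, S.coe_δ, S.coe_ε, S.coe_η, S.coe_θ] <;>
    (repeat rw [coe_ofNat]) <;> (repeat rw [map_ofNat]) <;> field_simp <;> ring
  · refine S.mem_latticeS.mpr ⟨0, 0, 1, 0, ?_, ?_, ?_, ?_⟩ <;>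
      simp [α, basisS, S.coe_δ, S.coe_ε, S.coe_η, S.coe_θ] <;>
    (repeat rw [coe_ofNat]) <;> (repeat rw [map_ofNat]) <;> field_simp <;> ring

theorem basisS_mul_j (S : Ramified F) :
    S.basisS 0 * ⟨0, 0, 1, 0⟩ ∈ S.latticeS ∧
    S.basisS 1 * ⟨0, 0, 1, 0⟩ ∈ S.latticeS ∧
    S.basisS 2 * ⟨0, 0, 1, 0⟩ ∈ S.latticeS ∧
    S.basisS 3 * ⟨0, 0, 1, 0⟩ ∈ S.latticeS := by
  have ht := S.coe_t_ne_zero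
  refine ⟨?_, ?_, ?_, ?_⟩
  · refine S.mem_latticeS.mpr ⟨-1, 0, -2 * S.η + S.t, 0, ?_, ?_, ?_, ?_⟩ <;>
      simp [α, basisS, S.coe_δ, S.coe_ε, S.coe_η, S.coe_θ] <;>
    (repeat rw [coe_ofNat]) <;> (repeat rw [map_ofNat]) <;> field_simp <;> ring
  · refine S.mem_latticeS.mpr ⟨0, -1, 0, -2 * S.η + S.t, ?_, ?_, ?_, ?_⟩ <;>
      simp [α, basisS, S.coe_δ, S.coe_ε, S.coe_η, S.coe_θ] <;>
    (repeat rw [coe_ofNat]) <;> (repeat rw [map_ofNat]) <;> field_simp <;> ring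
  · refine S.mem_latticeS.mpr ⟨-S.t, 0, 1, 0, ?_, ?_, ?_, ?_⟩ <;>
      simp [α, basisS, S.coe_δ, S.coe_ε, S.coe_η, S.coe_θ] <;>
    (repeat rw [coe_ofNat]) <;> (repeat rw [map_ofNat]) <;> field_simp <;> ring
  · refine S.mem_latticeS.mpr ⟨0, -S.t, 0, 1, ?_, ?_, ?_, ?_⟩ <;>
      simp [α, basisS, S.coe_δ, S.coe_ε, S.coe_η, S.coe_θ] <;>
    (repeat rw [coe_ofNat]) <;> (repeat rw [map_ofNat]) <;> field_simp <;> ring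

theorem basisS_mul_basis (S : Ramified F) :
    S.basisS 0 * S.basisS 0 ∈ S.latticeS ∧
    S.basisS 1 * S.basisS 0 ∈ S.latticeS ∧
    S.basisS 2 * S.basisS 0 ∈ S.latticeS ∧
    S.basisS 3 * S.basisS 0 ∈ S.latticeS := by
  have ht := S.coe_t_ne_zero
  refine ⟨?_, ?_, ?_, ?_⟩
  · refine S.mem_latticeS.mpr ⟨-1, -2 * S.η + S.t, -2 * S.η + S.t, -S.δ, ?_, ?_, ?_, ?_⟩ <;>
      simp [α, basisS, S.coe_δ, S.coe_ε, S.coe_η, S.coe_θ] <;>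
    (repeat rw [coe_ofNat]) <;> (repeat rw [map_ofNat]) <;> field_simp <;> ring
  · refine S.mem_latticeS.mpr ⟨-S.t, 1, 1, 0, ?_, ?_, ?_, ?_⟩ <;>
      simp [α, basisS, S.coe_δ, S.coe_ε, S.coe_η, S.coe_θ] <;>
    (repeat rw [coe_ofNat]) <;> (repeat rw [map_ofNat]) <;> field_simp <;> ring
  · refine S.mem_latticeS.mpr ⟨-S.t, 1, 2, 2 * S.η - S.t, ?_, ?_, ?_, ?_⟩ <;>
      simp [α, basisS, S.coe_δ, S.coe_ε, S.coe_η, S.coe_θ] <;>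
    (repeat rw [coe_ofNat]) <;> (repeat rw [map_ofNat]) <;> field_simp <;> ring
  · refine S.mem_latticeS.mpr ⟨-(S.ε : 𝓞 F), 0, S.t, 0, ?_, ?_, ?_, ?_⟩ <;>
      simp [α, basisS, S.coe_δ, S.coe_ε, S.coe_η, S.coe_θ] <;>
    (repeat rw [coe_ofNat]) <;> (repeat rw [map_ofNat]) <;> field_simp <;> ring

theorem one_mem_latticeD (S : Ramified F) : 1 ∈ S.latticeD := by
  have ht := S.coe_t_ne_zero
  refine S.mem_latticeD.mpr ⟨2 * S.η - S.t, 0, -2 * S.θ + S.δ - S.η - 1 + S.t,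
    -2 * S.θ + 2 * S.δ + S.η - 1, ?_, ?_, ?_, ?_⟩ <;>
    simp [α, basisD, S.coe_δ, S.coe_ε, S.coe_η, S.coe_θ] <;>
    (repeat rw [coe_ofNat]) <;> (repeat rw [map_ofNat]) <;> field_simp <;> ring

theorem α_mem_latticeD (S : Ramified F) : S.α ∈ S.latticeD := by
  have ht := S.coe_t_ne_zero
  refine S.mem_latticeD.mpr ⟨0, 0, S.δ, 0, ?_, ?_, ?_, ?_⟩ <;>
    simp [α, basisD, S.coe_δ, S.coe_ε, S.coe_η, S.coe_θ] <;>
    (repeat rw [coe_ofNat]) <;> (repeat rw [map_ofNat]) <;> field_simp <;> ring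

theorem j_mem_latticeD (S : Ramified F) : ⟨0, 0, 1, 0⟩ ∈ S.latticeD := by
  have ht := S.coe_t_ne_zero
  refine S.mem_latticeD.mpr ⟨0, 2 * S.η - S.t, -2 * S.θ + 2 * S.δ + S.η - 1,
    -2 * S.θ + S.δ - S.η - 1 + S.t, ?_, ?_, ?_, ?_⟩ <;>
    simp [α, basisD, S.coe_δ, S.coe_ε, S.coe_η, S.coe_θ] <;>
    (repeat rw [coe_ofNat]) <;> (repeat rw [map_ofNat]) <;> field_simp <;> ring

theorem basisD_mul_α (S : Ramified F) :
    S.basisD 0 * S.α ∈ S.latticeD ∧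
    S.basisD 1 * S.α ∈ S.latticeD ∧
    S.basisD 2 * S.α ∈ S.latticeD ∧
    S.basisD 3 * S.α ∈ S.latticeD := by
  have ht := S.coe_t_ne_zero
  refine ⟨?_, ?_, ?_, ?_⟩
  · refine S.mem_latticeD.mpr ⟨-2 * S.θ + S.δ - S.η - 1 + S.t, 2 * S.θ - 2 * S.δ - S.η + 1,
      4 * S.η * S.θ + 8 * S.θ - 6 * S.δ + 7 - 2 * S.η - (S.ε : 𝓞 F), 0, ?_, ?_, ?_, ?_⟩ <;>
      simp [α, basisD, S.coe_δ, S.coe_ε, S.coe_η, S.coe_θ] <;>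
    (repeat rw [coe_ofNat]) <;> (repeat rw [map_ofNat]) <;> field_simp <;> ring
  · refine S.mem_latticeD.mpr ⟨-2 * S.θ + 2 * S.δ + S.η - 1, 2 * S.θ - S.δ - S.η + 1, 0,
      -4 * S.η * S.θ - 8 * S.θ + 6 * S.δ - 7 + 2 * S.η + (S.ε : 𝓞 F), ?_, ?_, ?_, ?_⟩ <;>
      simp [α, basisD, S.coe_δ, S.coe_ε, S.coe_η, S.coe_θ] <;>
    (repeat rw [coe_ofNat]) <;> (repeat rw [map_ofNat]) <;> field_simp <;> ring
  · refine S.mem_latticeD.mpr ⟨-2 * S.η + S.t, 0, 2 * S.θ - S.δ - S.η + 1,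
      2 * S.θ - 2 * S.δ - S.η + 1, ?_, ?_, ?_, ?_⟩ <;>
      simp [α, basisD, S.coe_δ, S.coe_ε, S.coe_η, S.coe_θ] <;>
    (repeat rw [coe_ofNat]) <;> (repeat rw [map_ofNat]) <;> field_simp <;> ring
  · refine S.mem_latticeD.mpr ⟨0, 2 * S.η - S.t, -2 * S.θ + 2 * S.δ + S.η - 1,
      -2 * S.θ + S.δ - S.η - 1 + S.t, ?_, ?_, ?_, ?_⟩ <;>
      simp [α, basisD, S.coe_δ, S.coe_ε, S.coe_η, S.coe_θ] <;>
    (repeat rw [coe_ofNat]) <;> (repeat rw [map_ofNat]) <;> field_simp <;> ring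

theorem basisD_mul_j (S : Ramified F) :
    S.basisD 0 * ⟨0, 0, 1, 0⟩ ∈ S.latticeD ∧
    S.basisD 1 * ⟨0, 0, 1, 0⟩ ∈ S.latticeD ∧
    S.basisD 2 * ⟨0, 0, 1, 0⟩ ∈ S.latticeD ∧
    S.basisD 3 * ⟨0, 0, 1, 0⟩ ∈ S.latticeD := by
  have ht := S.coe_t_ne_zero
  refine ⟨?_, ?_, ?_, ?_⟩
  · refine S.mem_latticeD.mpr ⟨0, 1, S.δ + 2 * S.η - 1 - S.t, 0, ?_, ?_, ?_, ?_⟩ <;>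
      simp [α, basisD, S.coe_δ, S.coe_ε, S.coe_η, S.coe_θ] <;>
    (repeat rw [coe_ofNat]) <;> (repeat rw [map_ofNat]) <;> field_simp <;> ring
  · refine S.mem_latticeD.mpr ⟨-1, 0, 0, -S.δ - 2 * S.η + 1 + S.t, ?_, ?_, ?_, ?_⟩ <;>
      simp [α, basisD, S.coe_δ, S.coe_ε, S.coe_η, S.coe_θ] <;>
    (repeat rw [coe_ofNat]) <;> (repeat rw [map_ofNat]) <;> field_simp <;> ring
  · refine S.mem_latticeD.mpr ⟨0, 0, 0, 1, ?_, ?_, ?_, ?_⟩ <;>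
      simp [α, basisD, S.coe_δ, S.coe_ε, S.coe_η, S.coe_θ] <;>
    (repeat rw [coe_ofNat]) <;> (repeat rw [map_ofNat]) <;> field_simp <;> ring
  · refine S.mem_latticeD.mpr ⟨0, 0, -1, 0, ?_, ?_, ?_, ?_⟩ <;>
      simp [α, basisD, S.coe_δ, S.coe_ε, S.coe_η, S.coe_θ] <;>
    (repeat rw [coe_ofNat]) <;> (repeat rw [map_ofNat]) <;> field_simp <;> ring

theorem basisD_mul_basis (S : Ramified F) :
    S.basisD 0 * S.basisD 0 ∈ S.latticeD ∧
    S.basisD 1 * S.basisD 0 ∈ S.latticeD ∧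
    S.basisD 2 * S.basisD 0 ∈ S.latticeD ∧
    S.basisD 3 * S.basisD 0 ∈ S.latticeD := by
  have ht := S.coe_t_ne_zero
  refine ⟨?_, ?_, ?_, ?_⟩
  · refine S.mem_latticeD.mpr ⟨2 * S.θ - 2 * S.δ + S.η + 2 + S.t, 0,
      S.δ * S.θ + 4 * S.η * S.θ + S.θ - 2 * S.η ^ 2 - S.η - S.t,
      S.δ * S.θ + 6 * S.η * S.θ + 7 * S.θ - 11 * S.η ^ 2 - 5 - 2 * S.η + 4 * (S.ε : 𝓞 F), ?_, ?_,
      ?_, ?_⟩ <;>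
      simp [α, basisD, S.coe_δ, S.coe_ε, S.coe_η, S.coe_θ] <;>
    (repeat rw [coe_ofNat]) <;> (repeat rw [map_ofNat]) <;> field_simp <;> ring
  · refine S.mem_latticeD.mpr ⟨2 * S.θ - 2 * S.δ + S.η + 3, -S.δ - 2 * S.η + 1,
      S.δ * S.θ + 6 * S.η * S.θ + 7 * S.θ - 11 * S.η ^ 2 - 5 - 2 * S.η + 4 * (S.ε : 𝓞 F),
      S.δ * S.θ + 8 * S.η * S.θ + 11 * S.θ - 14 * S.η ^ 2 - 5 + S.η + 5 * (S.ε : 𝓞 F), ?_, ?_,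
      ?_, ?_⟩ <;>
      simp [α, basisD, S.coe_δ, S.coe_ε, S.coe_η, S.coe_θ] <;>
    (repeat rw [coe_ofNat]) <;> (repeat rw [map_ofNat]) <;> field_simp <;> ring
  · refine S.mem_latticeD.mpr ⟨S.η + S.t, S.η + 1, -2 * S.θ + 2 * S.δ - 2 - S.t,
      -2 * S.θ + 2 * S.δ - S.η - 3, ?_, ?_, ?_, ?_⟩ <;>
      simp [α, basisD, S.coe_δ, S.coe_ε, S.coe_η, S.coe_θ] <;>
    (repeat rw [coe_ofNat]) <;> (repeat rw [map_ofNat]) <;> field_simp <;> ring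
  · refine S.mem_latticeD.mpr ⟨S.η + 1, -S.η - S.t, 0, S.δ + 3 * S.η - 1, ?_, ?_, ?_, ?_⟩ <;>
      simp [α, basisD, S.coe_δ, S.coe_ε, S.coe_η, S.coe_θ] <;>
    (repeat rw [coe_ofNat]) <;> (repeat rw [map_ofNat]) <;> field_simp <;> ring

theorem basisS_two (S : Ramified F) : S.basisS 2 = ((S.ε : 𝓞 F) : F) • (S.α * ⟨0, 0, 1, 0⟩) := by
  have ht := S.coe_t_ne_zero
  ext <;> simp [-algebraMap_smul, α, basisS, S.coe_ε] <;> field_simp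

theorem basisS_three (S : Ramified F) : S.basisS 3 =
    ((S.ε : 𝓞 F) : F) • ((S.t : F) • (S.α * ⟨0, 0, 1, 0⟩) - ⟨0, 0, 1, 0⟩) := by
  have ht := S.coe_t_ne_zero
  ext <;> simp [-algebraMap_smul, α, basisS, S.coe_ε] <;> field_simp <;> simp

theorem basisS_one (S : Ramified F) : S.basisS 1 = (S.t : F) • S.basisS 0 -
    ((S.ε : 𝓞 F) : F) • (S.basisS 0 * S.α - S.basisS 0 * S.α * S.basisS 0) := by
  have ht := S.coe_t_ne_zero
  ext <;> simp [-algebraMap_smul, α, basisS, S.coe_ε] <;> field_simp <;> ring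

theorem basisD_one (S : Ramified F) : S.basisD 1 = S.basisD 0 * ⟨0, 0, 1, 0⟩ +
    (((1 + S.η) * S.t : 𝓞 F) : F) • S.α := by
  have ht := S.coe_t_ne_zero
  ext <;> simp [-algebraMap_smul, α, basisD] <;> field_simp <;> ring

theorem basisD_two (S : Ramified F) : S.basisD 2 = ((S.ε : 𝓞 F) : F) • S.α := by
  have ht := S.coe_t_ne_zero
  ext <;> simp [-algebraMap_smul, α, basisD, S.coe_ε] <;> field_simp

theorem basisD_three (S : Ramified F) :
    S.basisD 3 = ((S.ε : 𝓞 F) : F) • (S.α * ⟨0, 0, 1, 0⟩) := by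
  have ht := S.coe_t_ne_zero
  ext <;> simp [-algebraMap_smul, α, basisD, S.coe_ε] <;> field_simp

theorem mul_mem_latticeS (S : Ramified F) (y x : ℍ[F,-1,-1]) (hy : y ∈ S.latticeS)
    (hx : x ∈ S.latticeS) : y * x ∈ S.latticeS := by
  obtain ⟨a₁, a₂, a₃, a₄⟩ := S.basisS_mul_α
  obtain ⟨j₁, j₂, j₃, j₄⟩ := S.basisS_mul_j
  obtain ⟨w₁, w₂, w₃, w₄⟩ := S.basisS_mul_basis
  have ha : ∀ y ∈ S.latticeS, y * S.α ∈ S.latticeS := fun y hy => mul_mem_lattice a₁ a₂ a₃ a₄ hy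
  have hj : ∀ y ∈ S.latticeS, y * ⟨0, 0, 1, 0⟩ ∈ S.latticeS :=
    fun y hy => mul_mem_lattice j₁ j₂ j₃ j₄ hy
  have hw : ∀ y ∈ S.latticeS, y * S.basisS 0 ∈ S.latticeS :=
    fun y hy => mul_mem_lattice w₁ w₂ w₃ w₄ hy
  refine mul_mem_lattice_of_basis hw (fun y hy => ?_) (fun y hy => ?_) (fun y hy => ?_) y x hy hx
  · change y * S.basisS 1 ∈ S.latticeS
    rw [basisS_one, mul_sub, mul_smul_comm, mul_smul_comm, mul_sub, ← mul_assoc, ← mul_assoc,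
      ← mul_assoc]
    exact sub_mem (smul_mem_lattice _ (hw y hy)) (smul_mem_lattice _
      (sub_mem (ha _ (hw y hy)) (hw _ (ha _ (hw y hy)))))
  · change y * S.basisS 2 ∈ S.latticeS
    rw [basisS_two, mul_smul_comm, ← mul_assoc]
    exact smul_mem_lattice _ (hj _ (ha y hy))
  · change y * S.basisS 3 ∈ S.latticeS
    rw [basisS_three, mul_smul_comm, mul_sub, mul_smul_comm, ← mul_assoc]
    exact smul_mem_lattice _ (sub_mem (smul_mem_lattice _ (hj _ (ha y hy))) (hj y hy))

theorem mul_mem_latticeD (S : Ramified F) (y x : ℍ[F,-1,-1]) (hy : y ∈ S.latticeD)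
    (hx : x ∈ S.latticeD) : y * x ∈ S.latticeD := by
  obtain ⟨a₁, a₂, a₃, a₄⟩ := S.basisD_mul_α
  obtain ⟨j₁, j₂, j₃, j₄⟩ := S.basisD_mul_j
  obtain ⟨w₁, w₂, w₃, w₄⟩ := S.basisD_mul_basis
  have ha : ∀ y ∈ S.latticeD, y * S.α ∈ S.latticeD := fun y hy => mul_mem_lattice a₁ a₂ a₃ a₄ hy
  have hj : ∀ y ∈ S.latticeD, y * ⟨0, 0, 1, 0⟩ ∈ S.latticeD :=
    fun y hy => mul_mem_lattice j₁ j₂ j₃ j₄ hy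
  have hw : ∀ y ∈ S.latticeD, y * S.basisD 0 ∈ S.latticeD :=
    fun y hy => mul_mem_lattice w₁ w₂ w₃ w₄ hy
  refine mul_mem_lattice_of_basis hw (fun y hy => ?_) (fun y hy => ?_) (fun y hy => ?_) y x hy hx
  · change y * S.basisD 1 ∈ S.latticeD
    rw [basisD_one, mul_add, mul_smul_comm, ← mul_assoc]
    exact add_mem (hj _ (hw y hy)) (smul_mem_lattice _ (ha y hy))
  · change y * S.basisD 2 ∈ S.latticeD
    rw [basisD_two, mul_smul_comm]
    exact smul_mem_lattice _ (ha y hy)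
  · change y * S.basisD 3 ∈ S.latticeD
    rw [basisD_three, mul_smul_comm, ← mul_assoc]
    exact smul_mem_lattice _ (hj _ (ha y hy))

/-- The maximal order with reduced unit group `S₄`. -/
def orderS (S : Ramified F) : Subring ℍ[F,-1,-1] :=
  latticeRing S.latticeS S.one_mem_latticeS S.mul_mem_latticeS

/-- The maximal order with reduced unit group `D₄`. -/
def orderD (S : Ramified F) : Subring ℍ[F,-1,-1] :=
  latticeRing S.latticeD S.one_mem_latticeD S.mul_mem_latticeD

theorem isOrder_orderS (S : Ramified F) : IsOrder F S.orderS :=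
  S.isOrder_latticeRing S.one_mem_latticeS S.mul_mem_latticeS S.α_mem_latticeS S.j_mem_latticeS

theorem isOrder_orderD (S : Ramified F) : IsOrder F S.orderD :=
  S.isOrder_latticeRing S.one_mem_latticeD S.mul_mem_latticeD S.α_mem_latticeD S.j_mem_latticeD

end Ramified

section Maximality

variable {F}

theorem IsOrder.isIntegral_trace_nrd {K : Type} [Field K] {O : Subring ℍ[K,-1,-1]}
    (hO : IsOrder K O) {x : ℍ[K,-1,-1]} (hx : x ∈ O) :
    IsIntegral ℤ (2 * x.re) ∧ IsIntegral ℤ (nrd x) := by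
  by_cases h : ∃ a : K, algebraMap K _ a = x
  · obtain ⟨a, rfl⟩ := h
    have ha := isIntegral_of_algebraMap (hO.isIntegral hx)
    have h2 : IsIntegral ℤ (2 : K) := by
      simpa using isIntegral_algebraMap (R := ℤ) (A := K) (x := 2)
    constructor
    · simpa using h2.mul ha
    · simpa [nrd, QuaternionAlgebra.algebraMap_eq] using ha.pow 2
  · push Not at h
    refine isIntegral_of_quadratic (hO.isIntegral hx) ?_ h
    ext <;> simp [nrd, QuaternionAlgebra.algebraMap_eq] <;> ring

theorem val_eq_algebraMap (x : 𝓞 F) : RingOfIntegers.val x = algebraMap (𝓞 F) F x := rfl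

namespace Ramified

theorem ρ_two (S : Ramified F) : S.ρ 2 = 0 := by
  rw [S.ρ_eq_zero, S.two_eq]
  exact ⟨_, mul_assoc _ _ _⟩

theorem not_t_dvd_one (S : Ramified F) : ¬ S.t ∣ 1 := by
  rw [← S.ρ_eq_zero, map_one]; exact one_ne_zero

theorem exists_coordinates (S : Ramified F) {O : Subring ℍ[F,-1,-1]} (hO : IsOrder F O)
    (hα : S.α ∈ O) (hj : (⟨0, 0, 1, 0⟩ : ℍ[F,-1,-1]) ∈ O) {x : ℍ[F,-1,-1]} (hx : x ∈ O) :
    ∃ A E C G n : 𝓞 F, x.re = (A : F) / 2 ∧ x.imI = ((A : F) + S.t * E) / 2 ∧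
      x.imJ = (C : F) / 2 ∧ x.imK = ((C : F) + S.t * G) / 2 ∧
      A ^ 2 + C ^ 2 + S.t * (A * E + C * G) + S.ε * (E ^ 2 + G ^ 2) = 2 * n := by
  have ht := S.coe_t_ne_zero
  have tr : ∀ y ∈ O, ∃ r : 𝓞 F, (r : F) = 2 * y.re := fun y hy =>
    ⟨⟨_, (hO.isIntegral_trace_nrd hy).1⟩, rfl⟩
  obtain ⟨A, hA⟩ := tr _ hx
  obtain ⟨E, hE⟩ := tr _ (O.mul_mem hx hα)
  obtain ⟨C, hC⟩ := tr _ (O.mul_mem hx hj)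
  obtain ⟨G, hG⟩ := tr _ (O.mul_mem hx (O.mul_mem hj hα))
  obtain ⟨n, hn⟩ : ∃ n : 𝓞 F, (n : F) = nrd x := ⟨⟨_, (hO.isIntegral_trace_nrd hx).2⟩, rfl⟩
  simp only [val_eq_algebraMap] at hA hE hC hG hn
  simp [α] at hE hC hG
  have h1 : x.re = algebraMap (𝓞 F) F A / 2 := by rw [hA]; ring
  have h2 : x.imI = (algebraMap (𝓞 F) F A + S.t * algebraMap (𝓞 F) F (-E)) / 2 := by
    rw [map_neg, hA, hE]; field_simp; ring
  have h3 : x.imJ = algebraMap (𝓞 F) F (-C) / 2 := by rw [map_neg, hC]; ring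
  have h4 : x.imK = (algebraMap (𝓞 F) F (-C) + S.t * algebraMap (𝓞 F) F G) / 2 := by
    rw [map_neg, hC, hG]; field_simp; ring
  refine ⟨A, -E, -C, G, n, h1, h2, h3, h4, RingOfIntegers.coe_injective ?_⟩
  have e := S.coe_ε
  simp only [map_add, map_mul, map_pow]
  rw [map_ofNat, hn, nrd, h1, h2, h3, h4]
  simp only [val_eq_algebraMap] at e ⊢
  linear_combination (algebraMap (𝓞 F) F (-E) ^ 2 + algebraMap (𝓞 F) F G ^ 2) * e

theorem mem_latticeS_or_mem_latticeD (S : Ramified F) {O : Subring ℍ[F,-1,-1]} (hO : IsOrder F O)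
    (hα : S.α ∈ O) (hj : (⟨0, 0, 1, 0⟩ : ℍ[F,-1,-1]) ∈ O) {x : ℍ[F,-1,-1]} (hx : x ∈ O) :
    x ∈ S.latticeS ∨ x ∈ S.latticeD := by
  obtain ⟨A, E, C, G, n, h1, h2, h3, h4, heq⟩ := S.exists_coordinates hO hα hj hx
  have hsum := congrArg S.ρ heq
  simp only [map_add, map_mul, map_pow, S.ρ_t, S.ρ_two, S.ρ_unit] at hsum
  by_cases hAC : S.ρ C = S.ρ A
  · have hEG : S.ρ G = S.ρ E := by
      rw [hAC] at hsum
      generalize S.ρ n = m at hsum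
      revert hsum
      generalize S.ρ A = a; generalize S.ρ E = e; generalize S.ρ G = g
      revert a e g m; decide
    obtain ⟨p, hp⟩ := S.dvd_sub_of_ρ_eq hAC
    obtain ⟨q, hq⟩ := S.dvd_sub_of_ρ_eq hEG
    rw [sub_eq_iff_eq_add] at hp hq
    left
    refine S.mem_latticeS.mpr ⟨A, E, p, q, h1, h2, ?_, ?_⟩
    · rw [h3, hp]; push_cast; ring
    · rw [h4, hp, hq]; push_cast; ring
  · have hC : S.ρ C = S.ρ (A + 1) := by
      rw [map_add, map_one]
      revert hAC
      generalize S.ρ A = a; generalize S.ρ C = c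
      revert a c; decide
    have hG : S.ρ G = S.ρ (E + 1) := by
      rw [map_add, map_one] at *
      rw [hC] at hsum
      generalize S.ρ n = m at hsum
      revert hsum
      generalize S.ρ A = a; generalize S.ρ E = e; generalize S.ρ G = g
      revert a e g m; decide
    obtain ⟨m, hm⟩ := S.dvd_sub_of_ρ_eq hC
    obtain ⟨l, hl⟩ := S.dvd_sub_of_ρ_eq hG
    rw [sub_eq_iff_eq_add] at hm hl
    have hη : S.t ∣ A * E + C * G + S.η := by
      let U := A ^ 2 + A + S.t * m * (A + 1)
      let V := E ^ 2 + E + S.t * l * (E + 1)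
      refine ⟨S.δ * (n - 1 - U - S.ε * V) - m ^ 2 - S.ε * l ^ 2, mul_left_cancel₀ S.t_ne_zero ?_⟩
      rw [hm, hl] at heq ⊢
      linear_combination heq + (n - 1 - U - S.ε * V) * S.two_eq - S.ε_eq
    have hη' := S.ρ_eq_zero.mpr hη
    simp only [map_add, map_mul, map_one] at hη' hC hG
    have key : ∀ a e η : ZMod 2, a * e + (a + 1) * (e + 1) + η = 0 →
        a = η * e + (1 + η) * (e + 1) ∧ a + 1 = η * (e + 1) + (1 + η) * e := by decide
    rw [hC, hG] at hη'
    obtain ⟨k1, k2⟩ := key _ _ _ hη'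
    obtain ⟨p, hp⟩ := S.dvd_sub_of_ρ_eq (x := A) (y := S.η * E + (1 + S.η) * G) (by
      simp only [map_add, map_mul, map_one, hG]; exact k1)
    obtain ⟨q, hq⟩ := S.dvd_sub_of_ρ_eq (x := C) (y := S.η * G + (1 + S.η) * E) (by
      simp only [map_add, map_mul, map_one, hG, hC]; exact k2)
    rw [sub_eq_iff_eq_add] at hp hq
    right
    refine S.mem_latticeD.mpr ⟨E, G, p, q, ?_, ?_, ?_, ?_⟩
    · rw [h1, hp]; push_cast; ring
    · rw [h2, hp]; push_cast; ring
    · rw [h3, hq]; push_cast; ring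
    · rw [h4, hq]; push_cast; ring

theorem le_orderS_or_le_orderD (S : Ramified F) {O : Subring ℍ[F,-1,-1]} (hO : IsOrder F O)
    (hα : S.α ∈ O) (hj : (⟨0, 0, 1, 0⟩ : ℍ[F,-1,-1]) ∈ O) :
    O ≤ S.orderS ∨ O ≤ S.orderD := by
  by_contra! h
  obtain ⟨h1, h2⟩ := h
  obtain ⟨x, hx, hxS⟩ := SetLike.not_le_iff_exists.mp h1
  obtain ⟨y, hy, hyD⟩ := SetLike.not_le_iff_exists.mp h2
  have key : ∀ z ∈ O, z ∈ S.orderS ∨ z ∈ S.orderD :=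
    fun z hz => S.mem_latticeS_or_mem_latticeD hO hα hj hz
  have hxD := (key x hx).resolve_left hxS
  have hyS := (key y hy).resolve_right hyD
  rcases key _ (O.add_mem hx hy) with h | h
  · exact hxS (by simpa using S.orderS.sub_mem h hyS)
  · exact hyD (by simpa using S.orderD.sub_mem h hxD)

theorem basisS_mem_orderS (S : Ramified F) : S.basisS 0 ∈ S.orderS :=
  S.mem_latticeS.mpr ⟨1, 0, 0, 0, by simp [basisS], by simp [basisS], by simp [basisS],
    by simp [basisS]⟩

theorem basisD_mem_orderD (S : Ramified F) : S.basisD 0 ∈ S.orderD :=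
  S.mem_latticeD.mpr ⟨1, 0, 0, 0, by simp [basisD], by simp [basisD], by simp [basisD],
    by simp [basisD]⟩

theorem not_orderS_le_orderD (S : Ramified F) : ¬ S.orderS ≤ S.orderD := by
  intro h
  obtain ⟨E, G, p, q, h1, h2, h3, h4⟩ := S.mem_latticeD.mp (h S.basisS_mem_orderS)
  have ht := S.coe_t_ne_zero
  simp [basisS] at h1 h2 h3 h4
  have hE : (S.t : F) * E = 0 := by linear_combination 2 * h1 - 2 * h2
  have hG : (S.t : F) * G = 0 := by linear_combination 2 * h3 - 2 * h4
  replace hE : (E : F) = 0 := (mul_eq_zero.mp hE).resolve_left ht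
  replace hG : (G : F) = 0 := (mul_eq_zero.mp hG).resolve_left ht
  refine S.not_t_dvd_one ⟨p, RingOfIntegers.coe_injective ?_⟩
  rw [map_one, map_mul, ← val_eq_algebraMap, ← val_eq_algebraMap]
  rw [hE, hG] at h1
  linear_combination 2 * h1

theorem not_orderD_le_orderS (S : Ramified F) : ¬ S.orderD ≤ S.orderS := by
  intro h
  obtain ⟨A, E, p, q, h1, h2, h3, h4⟩ := S.mem_latticeS.mp (h S.basisD_mem_orderD)
  refine S.not_t_dvd_one ⟨p, RingOfIntegers.coe_injective ?_⟩
  rw [map_one, map_mul, ← val_eq_algebraMap, ← val_eq_algebraMap]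
  simp only [basisD, Matrix.cons_val_zero] at h1 h3
  linear_combination 2 * h3 - 2 * h1

theorem isMaximalOrder_orderS (S : Ramified F) : IsMaximalOrder F S.orderS := by
  refine ⟨S.isOrder_orderS, fun O' hO' hle => ?_⟩
  rcases S.le_orderS_or_le_orderD hO' (hle S.α_mem_latticeS) (hle S.j_mem_latticeS) with h | h
  · exact le_antisymm h hle
  · exact absurd (hle.trans h) S.not_orderS_le_orderD

theorem isMaximalOrder_orderD (S : Ramified F) : IsMaximalOrder F S.orderD := by
  refine ⟨S.isOrder_orderD, fun O' hO' hle => ?_⟩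
  rcases S.le_orderS_or_le_orderD hO' (hle S.α_mem_latticeD) (hle S.j_mem_latticeD) with h | h
  · exact absurd (hle.trans h) S.not_orderD_le_orderS
  · exact le_antisymm h hle

theorem eq_orderS_or_eq_orderD (S : Ramified F) {O : Subring ℍ[F,-1,-1]}
    (hO : IsMaximalOrder F O) (hα : S.α ∈ O) (hj : (⟨0, 0, 1, 0⟩ : ℍ[F,-1,-1]) ∈ O) :
    O = S.orderS ∨ O = S.orderD :=
  (S.le_orderS_or_le_orderD hO.1 hα hj).imp (fun h => (hO.2 _ S.isOrder_orderS h).symm)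
    (fun h => (hO.2 _ S.isOrder_orderD h).symm)

end Ramified

end Maximality

section Action

variable {K : Type} [Field K]

/-- Representatives of the four diagonals of the cube. -/
def diag : Fin 4 → ℍ[K,-1,-1] := ![⟨0, 1, 1, 1⟩, ⟨0, 1, -1, -1⟩, ⟨0, -1, 1, -1⟩, ⟨0, -1, -1, 1⟩]

/-- Conjugation by `x` permutes the diagonals of the cube according to `π`. -/
def Acts (x : ℍ[K,-1,-1]) (π : Equiv.Perm (Fin 4)) : Prop :=
  ∀ a, ∃ s : K, x * diag a = s • (diag (π a) * x)

theorem Acts.mul {x y : ℍ[K,-1,-1]} {π τ : Equiv.Perm (Fin 4)} (hx : Acts x π) (hy : Acts y τ) :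
    Acts (x * y) (π * τ) := by
  intro a
  obtain ⟨s, hs⟩ := hy a
  obtain ⟨r, hr⟩ := hx (τ a)
  refine ⟨s * r, ?_⟩
  rw [mul_assoc, hs, mul_smul_comm, ← mul_assoc, hr, smul_mul_assoc, smul_smul, mul_assoc]
  rfl

theorem acts_algebraMap (c : K) : Acts (algebraMap K ℍ[K,-1,-1] c) 1 :=
  fun a => ⟨1, by rw [one_smul, Algebra.commutes]; rfl⟩

theorem Acts.smul {x : ℍ[K,-1,-1]} {π : Equiv.Perm (Fin 4)} (hx : Acts x π) (c : K) :
    Acts (c • x) π := by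
  rw [Algebra.smul_def, ← one_mul π]
  exact (acts_algebraMap c).mul hx

theorem Acts.of_smul {x : ℍ[K,-1,-1]} {π : Equiv.Perm (Fin 4)} {c : K} (hc : c ≠ 0)
    (hx : Acts (c • x) π) : Acts x π := by
  simpa [smul_smul, inv_mul_cancel₀ hc] using hx.smul c⁻¹

theorem Acts.pow {x : ℍ[K,-1,-1]} {π : Equiv.Perm (Fin 4)} (hx : Acts x π) (n : ℕ) :
    Acts (x ^ n) (π ^ n) := by
  induction n with
  | zero => simpa using acts_algebraMap (1 : K)
  | succ n ih => rw [pow_succ, pow_succ]; exact ih.mul hx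

variable [CharZero K]

theorem diag_ne_zero (a : Fin 4) : (diag a : ℍ[K,-1,-1]) ≠ 0 := by
  intro h
  have := congrArg QuaternionAlgebra.imI h
  fin_cases a <;> simp [diag] at this

theorem eq_of_smul_diag_eq {a b : Fin 4} {s r : K} (hs : s ≠ 0)
    (h : s • (diag a : ℍ[K,-1,-1]) = r • diag b) : a = b := by
  have h1 := congrArg QuaternionAlgebra.imI h
  have h2 := congrArg QuaternionAlgebra.imJ h
  have h3 := congrArg QuaternionAlgebra.imK h
  clear h
  have h0 : (2 : K) ≠ 0 := two_ne_zero
  fin_cases a <;> fin_cases b <;> simp [diag] at h1 h2 h3 ⊢ <;> grind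

theorem Acts.unique (σ : K →+* ℝ) {x : ℍ[K,-1,-1]} (hx0 : x ≠ 0) {π τ : Equiv.Perm (Fin 4)}
    (hπ : Acts x π) (hτ : Acts x τ) : π = τ := by
  have hx := isUnit_of_ne_zero σ hx0
  ext1 a
  obtain ⟨s, hs⟩ := hπ a
  obtain ⟨r, hr⟩ := hτ a
  have hs0 : s ≠ 0 := by
    rintro rfl
    rw [zero_smul, hx.mul_right_eq_zero] at hs
    exact diag_ne_zero a hs
  rw [hs, ← smul_mul_assoc, ← smul_mul_assoc] at hr
  exact eq_of_smul_diag_eq hs0 (hx.mul_left_injective hr)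

theorem Acts.exists_eq_algebraMap (σ : K →+* ℝ) {x : ℍ[K,-1,-1]} (hx0 : x ≠ 0)
    (h : Acts x 1) : ∃ c : K, x = algebraMap K _ c := by
  have hx := isUnit_of_ne_zero σ hx0
  choose s hs using h
  simp only [Equiv.Perm.one_apply] at hs
  have hsum : (s 0 • diag 0 + s 1 • diag 1 + s 2 • diag 2 + s 3 • diag 3) * x = 0 := by
    simp only [add_mul, smul_mul_assoc, ← hs, ← mul_add]
    rw [hx.mul_right_eq_zero]
    ext <;> simp [diag]
  rw [hx.mul_left_eq_zero] at hsum
  have e1 := congrArg QuaternionAlgebra.imI hsum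
  have e2 := congrArg QuaternionAlgebra.imJ hsum
  have e3 := congrArg QuaternionAlgebra.imK hsum
  simp [diag] at e1 e2 e3
  have s1 : s 1 = s 0 := by linear_combination -(e2 + e3) / 2
  have s2 : s 2 = s 0 := by linear_combination -(e1 + e3) / 2
  have s3 : s 3 = s 0 := by linear_combination -(e1 + e2) / 2
  have hn := congrArg nrd (hs 0)
  have hsq : s 0 ^ 2 = 1 := by
    have : nrd (s 0 • (diag 0 * x)) = s 0 ^ 2 * nrd (diag 0 * x) := by
      rw [Algebra.smul_def, nrd_mul]; simp [nrd, QuaternionAlgebra.algebraMap_eq]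
    rw [this, nrd_mul, nrd_mul, mul_comm (nrd x)] at hn
    exact (mul_right_cancel₀ (mul_ne_zero (nrd_ne_zero σ (diag_ne_zero 0)) (nrd_ne_zero σ hx0))
      ((one_mul _).trans hn)).symm
  have h0 := hs 0
  have h1 := hs 1
  have h2 := hs 2
  rw [s1] at h1
  rw [s2] at h2
  have c0 := QuaternionAlgebra.ext_iff.mp h0
  have c1 := QuaternionAlgebra.ext_iff.mp h1
  have c2 := QuaternionAlgebra.ext_iff.mp h2
  obtain ⟨a1, a2, a3, a4⟩ := c0
  obtain ⟨b1, b2, b3, b4⟩ := c1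
  obtain ⟨d1, d2, d3, d4⟩ := c2
  have hcases : s 0 = 1 ∨ s 0 = -1 := by grind
  rcases hcases with hs0 | hs0 <;>
    rw [hs0] at a1 a2 a3 a4 b1 b2 b3 b4 d1 d2 d3 d4 <;>
    simp [diag] at a1 a2 a3 a4 b1 b2 b3 b4 d1 d2 d3 d4
  · refine ⟨x.re, ?_⟩
    ext <;> simp
    · grind
    · grind
    · grind
  · refine absurd ?_ hx0
    ext <;> simp
    · grind
    · grind
    · grind
    · grind

end Action

section UnitGroups

variable {F} {O : Subring ℍ[F,-1,-1]}

theorem redUnitIso_of_acts (σ : F →+* ℝ) (hO : IsOrder F O) {G : Type*} [Group G]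
    (f : G →* Equiv.Perm (Fin 4)) (hf : Function.Injective f)
    (h1 : ∀ u : (↥O)ˣ, ∃ g, Acts ((u : O) : ℍ[F,-1,-1]) (f g))
    (h2 : ∀ g, ∃ u : (↥O)ˣ, Acts ((u : O) : ℍ[F,-1,-1]) (f g)) : RedUnitIso F O G := by
  have hne (u : (↥O)ˣ) : ((u : O) : ℍ[F,-1,-1]) ≠ 0 := fun h => by
    have := coe_mul_inv u
    rw [h, zero_mul] at this
    exact zero_ne_one this
  have hunique {u : (↥O)ˣ} {g g' : G} (h : Acts ((u : O) : ℍ[F,-1,-1]) (f g))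
      (h' : Acts ((u : O) : ℍ[F,-1,-1]) (f g')) : g = g' := hf (h.unique σ (hne u) h')
  choose φ hφ using h1
  refine ⟨MonoidHom.mk' φ fun u v => hunique (hφ _) ?_, fun g => ?_, fun u => ⟨fun h => ?_, ?_⟩⟩
  · rw [map_mul]
    exact (hφ u).mul (hφ v)
  · obtain ⟨u, hu⟩ := h2 g
    exact ⟨u, hunique (hφ u) hu⟩
  · have hu := hφ u
    rw [show φ u = 1 from h, map_one] at hu
    obtain ⟨c, hc⟩ := hu.exists_eq_algebraMap σ (hne u)
    exact hO.isScalarUnit u hc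
  · rintro ⟨r, hr⟩
    refine hunique (hφ u) ?_
    rw [map_one, hr]
    exact acts_algebraMap _

theorem IsOrder.star_mem (hO : IsOrder F O) {x : ℍ[F,-1,-1]} (hx : x ∈ O) : star x ∈ O := by
  obtain ⟨r, hr⟩ : ∃ r : 𝓞 F, (r : F) = 2 * x.re :=
    ⟨⟨2 * x.re, (hO.isIntegral_trace_nrd hx).1⟩, rfl⟩
  have : star x = algebraMap F _ (r : F) - x := by
    rw [hr, two_mul, map_add]
    ext <;> simp
  rw [this]
  exact O.sub_mem (hO.algebraMap_mem r) hx

theorem IsOrder.exists_unit (hO : IsOrder F O) {x : ℍ[F,-1,-1]} (hx : x ∈ O) {e : 𝓞 F}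
    (h : nrd x * (e : F) = 1) : ∃ u : (↥O)ˣ, ((u : O) : ℍ[F,-1,-1]) = x := by
  refine ⟨⟨⟨x, hx⟩, ⟨_, hO.smul_mem e (hO.star_mem hx)⟩, Subtype.ext ?_, Subtype.ext ?_⟩, rfl⟩
  · change x * ((e : F) • star x) = 1
    rw [mul_smul_comm, mul_star_eq, Algebra.smul_def, ← map_mul, mul_comm, h, map_one]
  · change ((e : F) • star x) * x = 1
    rw [smul_mul_assoc, star_mul_eq, Algebra.smul_def, ← map_mul, mul_comm, h, map_one]

theorem nrd_smul {K : Type} [Field K] (c : K) (x : ℍ[K,-1,-1]) :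
    nrd (c • x) = c ^ 2 * nrd x := by
  simp [nrd]
  ring

theorem nrd_star {K : Type} [Field K] (x : ℍ[K,-1,-1]) : nrd (star x) = nrd x := by
  simp [nrd]

namespace Ramified

theorem nrd_α (S : Ramified F) : nrd S.α = (S.δ : F) := by
  have ht := S.coe_t_ne_zero
  have h1 : ((S.ε : 𝓞 F) : F) * (S.δ : F) = 1 := by
    rw [val_eq_algebraMap, val_eq_algebraMap, ← map_mul, S.ε_mul_δ, map_one]
  have h2 := S.coe_t_sq
  simp only [nrd, α]
  field_simp
  linear_combination (-2) * h1 - (S.δ : F) * h2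

theorem nrd_unit (S : Ramified F) (hO : IsOrder F O) (u : (↥O)ˣ) :
    ∃ k : ℤ, nrd ((u : O) : ℍ[F,-1,-1]) = ((S.ε : 𝓞 F) : F) ^ k := by
  obtain ⟨a, ha⟩ : ∃ a : 𝓞 F, (a : F) = nrd ((u : O) : ℍ[F,-1,-1]) :=
    ⟨⟨_, (hO.isIntegral_trace_nrd (u : O).2).2⟩, rfl⟩
  obtain ⟨b, hb⟩ : ∃ b : 𝓞 F, (b : F) = nrd (((u⁻¹ : (↥O)ˣ) : O) : ℍ[F,-1,-1]) :=
    ⟨⟨_, (hO.isIntegral_trace_nrd ((u⁻¹ : (↥O)ˣ) : O).2).2⟩, rfl⟩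
  have hab : a * b = 1 := by
    refine RingOfIntegers.coe_injective ?_
    rw [map_mul, ← val_eq_algebraMap, ← val_eq_algebraMap, ha, hb, ← nrd_mul, coe_mul_inv, map_one]
    simp [nrd]
  have hu0 : ((u : O) : ℍ[F,-1,-1]) ≠ 0 := fun h => by
    have := coe_mul_inv u
    rw [h, zero_mul] at this
    exact zero_ne_one this
  obtain ⟨k, hk⟩ := S.unit_eq_zpow (Units.mkOfMulEqOne a b hab) (by
    change 0 < S.σ (a : F)
    rw [ha]
    exact nrd_pos S.σ hu0)
  refine ⟨k, ?_⟩
  rw [← ha, val_eq_algebraMap, val_eq_algebraMap, ← S.coe_zpow, ← hk]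
  rfl

/-- Up to scalars, every unit is an element of norm one or such an element times `α`. -/
theorem exists_normOne (S : Ramified F) (hO : IsOrder F O) (hα : S.α ∈ O) (u : (↥O)ˣ) :
    ∃ w ∈ O, nrd w = 1 ∧ ∃ c : F, c ≠ 0 ∧
      (c • ((u : O) : ℍ[F,-1,-1]) = w ∨ c • ((u : O) : ℍ[F,-1,-1]) = w * S.α) := by
  obtain ⟨k, hk⟩ := S.nrd_unit hO u
  have hε : ((S.ε : 𝓞 F) : F) ≠ 0 := by
    rw [val_eq_algebraMap]
    exact (map_ne_zero_iff _ RingOfIntegers.coe_injective).mpr S.ε.ne_zero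
  have hδ : (S.δ : F) = ((S.ε : 𝓞 F) : F)⁻¹ := by
    refine eq_inv_of_mul_eq_one_right ?_
    rw [val_eq_algebraMap, val_eq_algebraMap, ← map_mul, S.ε_mul_δ, map_one]
  have hz (m : ℤ) {x : ℍ[F,-1,-1]} (hx : x ∈ O) : ((S.ε : 𝓞 F) : F) ^ m • x ∈ O := by
    have := hO.smul_mem ((S.ε ^ m : (𝓞 F)ˣ) : 𝓞 F) hx
    rwa [S.coe_zpow] at this
  rcases Int.even_or_odd' k with ⟨m, rfl | rfl⟩
  · refine ⟨_, hz (-m) (u : O).2, ?_, _, zpow_ne_zero (-m) hε, Or.inl rfl⟩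
    rw [nrd_smul, hk, ← zpow_natCast, ← zpow_mul, ← zpow_add₀ hε]
    convert zpow_zero _ using 2
    push_cast
    ring
  · refine ⟨_, hz (-m) (O.mul_mem (u : O).2 (hO.star_mem hα)), ?_,
      ((S.ε : 𝓞 F) : F) ^ (-m) * (S.δ : F), mul_ne_zero (zpow_ne_zero _ hε) (hδ ▸ inv_ne_zero hε),
      Or.inr ?_⟩
    · rw [nrd_smul, nrd_mul, nrd_star, nrd_α, hδ, hk, ← zpow_natCast, ← zpow_mul, zpow_add₀ hε,
        zpow_one,
        mul_inv_cancel_right₀ hε, ← zpow_add₀ hε]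
      convert zpow_zero _ using 2
      push_cast
      ring
    · rw [smul_mul_assoc, mul_assoc, star_mul_eq, nrd_α,
        ← Algebra.commutes (S.δ : F) ((u : O) : ℍ[F,-1,-1]),
        ← Algebra.smul_def (S.δ : F), smul_smul]

theorem exists_int_coordinates (S : Ramified F) (hO : IsOrder F O)
    (hα : S.α ∈ O) (hj : (⟨0, 0, 1, 0⟩ : ℍ[F,-1,-1]) ∈ O) {w : ℍ[F,-1,-1]} (hw : w ∈ O)
    (h1 : nrd w = 1) : ∃ a b c d : ℤ, w = ⟨a / 2, b / 2, c / 2, d / 2⟩ ∧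
      a ^ 2 + b ^ 2 + c ^ 2 + d ^ 2 = 4 := by
  obtain ⟨A, E, C, G, n, e1, e2, e3, e4, -⟩ := S.exists_coordinates hO hα hj hw
  rw [nrd, e1, e2, e3, e4] at h1
  obtain ⟨a, b, c, d, ha, hb, hc, hd, h⟩ := S.int_of_sum_four_squares
    (A := A) (B := A + S.t * E) (C := C) (D := C + S.t * G) (by
      refine RingOfIntegers.coe_injective ?_
      simp only [map_add, map_pow, map_mul, map_ofNat]
      simp only [← val_eq_algebraMap]
      linear_combination 4 * h1)
  refine ⟨a, b, c, d, ?_, h⟩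
  have cast (n : ℤ) (x : 𝓞 F) (h : x = n) : (x : F) = n := by
    rw [h, val_eq_algebraMap, map_intCast]
  have hb' := cast _ _ hb
  have hd' := cast _ _ hd
  rw [val_eq_algebraMap, map_add, map_mul] at hb' hd'
  simp only [← val_eq_algebraMap] at hb' hd'
  ext
  · rw [e1, cast _ _ ha]
  · rw [e2, hb']
  · rw [e3, cast _ _ hc]
  · rw [e4, hd']

end Ramified

end UnitGroups

section IntegerActions

/-- The `i`-coordinates of the diagonals `diag`. -/
def diagI : Fin 4 → ℤ := ![1, 1, -1, -1]

/-- The `j`-coordinates of the diagonals `diag`. -/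
def diagJ : Fin 4 → ℤ := ![1, -1, 1, -1]

/-- The `k`-coordinates of the diagonals `diag`. -/
def diagK : Fin 4 → ℤ := ![1, -1, -1, 1]

/-- Conjugation by `a + bi + cj + dk` sends the diagonal `m` to the diagonal `n`. -/
def IntActs (a b c d : ℤ) (m n : Fin 4) : Prop :=
  ∃ s ∈ ({1, -1} : Finset ℤ),
    -(b * diagI m + c * diagJ m + d * diagK m) = -s * (b * diagI n + c * diagJ n + d * diagK n) ∧
    a * diagI m + c * diagK m - d * diagJ m = s * (a * diagI n - c * diagK n + d * diagJ n) ∧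
    a * diagJ m + d * diagI m - b * diagK m = s * (a * diagJ n - d * diagI n + b * diagK n) ∧
    a * diagK m + b * diagJ m - c * diagI m = s * (a * diagK n - b * diagJ n + c * diagI n)

instance (a b c d : ℤ) (m n : Fin 4) : Decidable (IntActs a b c d m n) := by
  unfold IntActs
  infer_instance

variable {K : Type} [Field K]

theorem diag_eq (m : Fin 4) : (diag m : ℍ[K,-1,-1]) = ⟨0, diagI m, diagJ m, diagK m⟩ := by
  fin_cases m <;> simp [diag, diagI, diagJ, diagK]

theorem IntActs.exists_eq {a b c d : ℤ} {m n : Fin 4} (h : IntActs a b c d m n) :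
    ∃ s : K, (⟨a, b, c, d⟩ : ℍ[K,-1,-1]) * diag m = s • (diag n * ⟨a, b, c, d⟩) := by
  obtain ⟨s, -, h1, h2, h3, h4⟩ := h
  refine ⟨s, ?_⟩
  have h1 := congrArg (Int.cast : ℤ → K) h1
  have h2 := congrArg (Int.cast : ℤ → K) h2
  have h3 := congrArg (Int.cast : ℤ → K) h3
  have h4 := congrArg (Int.cast : ℤ → K) h4
  push_cast at h1 h2 h3 h4
  rw [diag_eq, diag_eq]
  ext <;> simp
  · linear_combination h1
  · linear_combination h2
  · linear_combination h3
  · linear_combination h4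

theorem acts_of_intActs {a b c d : ℤ} {π : Equiv.Perm (Fin 4)}
    (h : ∀ m, IntActs a b c d m (π m)) : Acts (⟨a, b, c, d⟩ : ℍ[K,-1,-1]) π :=
  fun m => (h m).exists_eq

theorem exists_intActs {a b c d : ℤ} (h : a ^ 2 + b ^ 2 + c ^ 2 + d ^ 2 = 4) (m : Fin 4) :
    ∃ n, IntActs a b c d m n := by
  have key : ∀ a ∈ Finset.Icc (-2 : ℤ) 2, ∀ b ∈ Finset.Icc (-2 : ℤ) 2,
      ∀ c ∈ Finset.Icc (-2 : ℤ) 2, ∀ d ∈ Finset.Icc (-2 : ℤ) 2,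
      a ^ 2 + b ^ 2 + c ^ 2 + d ^ 2 = 4 → ∀ m, ∃ n, IntActs a b c d m n := by
    decide +kernel
  refine key a ?_ b ?_ c ?_ d ?_ h m <;> rw [Finset.mem_Icc] <;> constructor <;> nlinarith

theorem cases_of_sum_four_squares {a b c d : ℤ} (h : a ^ 2 + b ^ 2 + c ^ 2 + d ^ 2 = 4) :
    (a % 2 = 1 ∧ b % 2 = 1 ∧ c % 2 = 1 ∧ d % 2 = 1) ∨
    (b = 0 ∧ c = 0 ∧ d = 0) ∨ (a = 0 ∧ c = 0 ∧ d = 0) ∨ (a = 0 ∧ b = 0 ∧ d = 0) ∨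
    (a = 0 ∧ b = 0 ∧ c = 0) := by
  have key : ∀ a ∈ Finset.Icc (-2 : ℤ) 2, ∀ b ∈ Finset.Icc (-2 : ℤ) 2,
      ∀ c ∈ Finset.Icc (-2 : ℤ) 2, ∀ d ∈ Finset.Icc (-2 : ℤ) 2,
      a ^ 2 + b ^ 2 + c ^ 2 + d ^ 2 = 4 →
      (a % 2 = 1 ∧ b % 2 = 1 ∧ c % 2 = 1 ∧ d % 2 = 1) ∨
      (b = 0 ∧ c = 0 ∧ d = 0) ∨ (a = 0 ∧ c = 0 ∧ d = 0) ∨ (a = 0 ∧ b = 0 ∧ d = 0) ∨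
      (a = 0 ∧ b = 0 ∧ c = 0) := by
    decide +kernel
  refine key a ?_ b ?_ c ?_ d ?_ h <;> rw [Finset.mem_Icc] <;> constructor <;> nlinarith

theorem exists_acts [CharZero K] (σ : K →+* ℝ) {a b c d : ℤ}
    (h : a ^ 2 + b ^ 2 + c ^ 2 + d ^ 2 = 4) :
    ∃ π, Acts (⟨a, b, c, d⟩ : ℍ[K,-1,-1]) π := by
  set x : ℍ[K,-1,-1] := ⟨a, b, c, d⟩ with hxdef
  have hx0 : x ≠ 0 := fun h0 => by
    have h4 : nrd x = 4 := by
      simp only [nrd, hxdef]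
      exact_mod_cast h
    rw [h0] at h4
    simp [nrd] at h4
  have hx := isUnit_of_ne_zero σ hx0
  choose n hn using exists_intActs h
  choose s hs using fun m => (hn m).exists_eq (K := K)
  have hs0 (m) : s m ≠ 0 := fun h0 => by
    have := hs m
    rw [h0, zero_smul, hx.mul_right_eq_zero] at this
    exact diag_ne_zero m this
  have hinj : Function.Injective n := fun m m' hm => by
    have h1 : x * (s m' • diag m) = x * (s m • diag m') := by
      rw [mul_smul_comm, mul_smul_comm, hs m, hs m', hm, smul_smul, smul_smul, mul_comm]
    exact eq_of_smul_diag_eq (hs0 m') (hx.mul_right_injective h1)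
  exact ⟨Equiv.ofBijective n (Finite.injective_iff_bijective.mp hinj), fun m => ⟨s m, hs m⟩⟩

/-- The permutation of the diagonals induced by `1 + i`. -/
def permα : Equiv.Perm (Fin 4) := ⟨![2, 3, 1, 0], ![3, 2, 0, 1], by decide, by decide⟩

/-- The permutation of the diagonals induced by `j`. -/
def permJ : Equiv.Perm (Fin 4) := ⟨![2, 3, 0, 1], ![2, 3, 0, 1], by decide, by decide⟩

/-- The permutation of the diagonals induced by `1 + i + j + k`. -/
def permω : Equiv.Perm (Fin 4) := ⟨![0, 2, 3, 1], ![0, 3, 1, 2], by decide, by decide⟩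

theorem acts_J : Acts (⟨0, 0, 1, 0⟩ : ℍ[K,-1,-1]) permJ := by
  simpa using acts_of_intActs (K := K) (a := 0) (b := 0) (c := 1) (d := 0) (π := permJ) (by decide)

theorem acts_ω : Acts (⟨1, 1, 1, 1⟩ : ℍ[K,-1,-1]) permω := by
  simpa using acts_of_intActs (K := K) (a := 1) (b := 1) (c := 1) (d := 1) (π := permω) (by decide)

theorem acts_one_add_I : Acts (⟨1, 1, 0, 0⟩ : ℍ[K,-1,-1]) permα := by
  simpa using acts_of_intActs (K := K) (a := 1) (b := 1) (c := 0) (d := 0) (π := permα) (by decide)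

theorem exists_eq_perm_mul (π : Equiv.Perm (Fin 4)) :
    ∃ a ∈ Finset.range 4, ∃ b ∈ Finset.range 2, ∃ c ∈ Finset.range 3,
      permα ^ a * permJ ^ b * permω ^ c = π := by
  revert π
  decide +kernel

/-- The embedding of `D₄` in `S₄` as the group of permutations generated by `permα`, `permJ`. -/
def dihedralPerm : DihedralGroup 4 →* Equiv.Perm (Fin 4) :=
  MonoidHom.mk' (fun g => match g with
    | .r i => permα ^ i.val
    | .sr i => permJ * permα ^ i.val) (by
    rintro (i | i) (j | j) <;> revert i j <;> decide +kernel)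

theorem dihedralPerm_injective : Function.Injective dihedralPerm := by
  rintro (i | i) (j | j) <;> revert i j <;> decide +kernel

end IntegerActions

namespace Ramified

variable {F} {O : Subring ℍ[F,-1,-1]}

theorem acts_α (S : Ramified F) : Acts S.α permα := by
  have : S.α = (S.t : F)⁻¹ • ⟨1, 1, 0, 0⟩ := by
    ext <;> simp [α]
  rw [this]
  exact acts_one_add_I.smul _

theorem exists_unit_α (S : Ramified F) (hO : IsOrder F O) (hα : S.α ∈ O) :
    ∃ u : (↥O)ˣ, ((u : O) : ℍ[F,-1,-1]) = S.α :=
  hO.exists_unit hα (e := S.ε) (by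
    rw [nrd_α, val_eq_algebraMap, val_eq_algebraMap, ← map_mul, mul_comm, S.ε_mul_δ, map_one])

theorem exists_unit_j (hO : IsOrder F O) (hj : (⟨0, 0, 1, 0⟩ : ℍ[F,-1,-1]) ∈ O) :
    ∃ u : (↥O)ˣ, ((u : O) : ℍ[F,-1,-1]) = ⟨0, 0, 1, 0⟩ :=
  hO.exists_unit hj (e := 1) (by rw [val_eq_algebraMap, map_one]; simp [nrd])

theorem exists_unit_ω (S : Ramified F) :
    ∃ u : (↥S.orderS)ˣ, ((u : S.orderS) : ℍ[F,-1,-1]) = (2⁻¹ : F) • ⟨1, 1, 1, 1⟩ := by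
  obtain ⟨u, hu⟩ := S.isOrder_orderS.exists_unit S.basisS_mem_orderS (e := 1) (by
    rw [val_eq_algebraMap, map_one]
    simp [nrd, basisS]
    norm_num)
  refine ⟨u, hu.trans ?_⟩
  ext <;> simp [basisS]

theorem acts_of_smul_eq (S : Ramified F) {x w : ℍ[F,-1,-1]} {c : F} (hc : c ≠ 0)
    (h : c • x = w ∨ c • x = w * S.α) {π : Equiv.Perm (Fin 4)} (hw : Acts w π) :
    Acts x π ∨ Acts x (π * permα) := by
  rcases h with h | h
  · exact Or.inl (Acts.of_smul hc (h ▸ hw))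
  · exact Or.inr (Acts.of_smul hc (h ▸ hw.mul S.acts_α))

theorem redUnitIso_orderS (S : Ramified F) : RedUnitIso F S.orderS (Equiv.Perm (Fin 4)) := by
  have hO := S.isOrder_orderS
  have hα : S.α ∈ S.orderS := S.α_mem_latticeS
  have hj : ⟨0, 0, 1, 0⟩ ∈ S.orderS := S.j_mem_latticeS
  refine redUnitIso_of_acts S.σ hO (MonoidHom.id _) Function.injective_id (fun u => ?_)
    (fun π => ?_)
  · obtain ⟨w, hw, h1, c, hc, h⟩ := S.exists_normOne hO hα u
    obtain ⟨a, b, p, q, hw', hsum⟩ := S.exists_int_coordinates hO hα hj hw h1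
    obtain ⟨π, hπ⟩ := exists_acts S.σ hsum
    have hwπ : Acts w π := by
      have : w = (2⁻¹ : F) • ⟨a, b, p, q⟩ := by
        rw [hw']
        ext <;> simp [div_eq_inv_mul]
      rw [this]
      exact hπ.smul _
    rcases S.acts_of_smul_eq hc h hwπ with h | h
    · exact ⟨_, h⟩
    · exact ⟨_, h⟩
  · obtain ⟨uα, hα⟩ := S.exists_unit_α hO hα
    obtain ⟨uj, hj⟩ := exists_unit_j hO hj
    obtain ⟨uω, hω⟩ := S.exists_unit_ω
    obtain ⟨a, -, b, -, c, -, rfl⟩ := exists_eq_perm_mul π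
    refine ⟨uα ^ a * uj ^ b * uω ^ c, ?_⟩
    simp only [Units.val_mul, Units.val_pow_eq_pow_val, Subring.coe_mul, Subring.coe_pow, hα, hj,
      hω]
    exact ((S.acts_α.pow a).mul (acts_J.pow b)).mul ((acts_ω.smul _).pow c)

theorem not_odd_of_mem_orderD (S : Ramified F) {a b c d : ℤ}
    (h : (⟨a / 2, b / 2, c / 2, d / 2⟩ : ℍ[F,-1,-1]) ∈ S.orderD) :
    ¬ (a % 2 = 1 ∧ b % 2 = 1 ∧ c % 2 = 1 ∧ d % 2 = 1) := by
  rintro ⟨ha, hb, hc, hd⟩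
  obtain ⟨E, G, p, q, h1, h2, h3, h4⟩ := S.mem_latticeD.mp h
  dsimp only at h1 h2 h3 h4
  have ht : S.t ≠ 0 := S.t_ne_zero
  have hE : S.t * E = ((b - a : ℤ) : 𝓞 F) := by
    refine RingOfIntegers.coe_injective ?_
    rw [map_mul, map_intCast, ← val_eq_algebraMap, ← val_eq_algebraMap, Int.cast_sub]
    linear_combination 2 * h1 - 2 * h2
  have hG : S.t * G = ((d - c : ℤ) : 𝓞 F) := by
    refine RingOfIntegers.coe_injective ?_
    rw [map_mul, map_intCast, ← val_eq_algebraMap, ← val_eq_algebraMap, Int.cast_sub]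
    linear_combination 2 * h3 - 2 * h4
  have hA : (a : 𝓞 F) = S.η * E + (1 + S.η) * G + S.t * p := by
    refine RingOfIntegers.coe_injective ?_
    simp only [map_add, map_mul, map_intCast, map_one]
    simp only [← val_eq_algebraMap]
    linear_combination 2 * h1
  have even {x y : ℤ} (hx : x % 2 = 1) (hy : y % 2 = 1) {Z : 𝓞 F}
      (hZ : S.t * Z = ((x - y : ℤ) : 𝓞 F)) : S.ρ Z = 0 := by
    obtain ⟨m, hm⟩ : ∃ m, x - y = 2 * m := ⟨(x - y) / 2, by omega⟩
    rw [hm, Int.cast_mul, Int.cast_ofNat, S.two_eq, mul_assoc, mul_assoc] at hZ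
    rw [mul_left_cancel₀ ht hZ, map_mul, S.ρ_t, zero_mul]
  have hρ := congrArg S.ρ hA
  simp only [map_add, map_mul, even hb ha hE, even hd hc hG, S.ρ_t, map_intCast] at hρ
  have : ((a : ℤ) : ZMod 2) = 1 := by
    rw [← Int.emod_add_mul_ediv a 2, ha]
    have h2 : (2 : ZMod 2) = 0 := rfl
    push_cast
    rw [h2]
    ring
  rw [this] at hρ
  simp at hρ

theorem exists_acts_orderD (S : Ramified F) {w : ℍ[F,-1,-1]} (hw : w ∈ S.orderD)
    (h1 : nrd w = 1) : ∃ g, Acts w (dihedralPerm g) := by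
  obtain ⟨a, b, c, d, rfl, hsum⟩ :=
    S.exists_int_coordinates S.isOrder_orderD S.α_mem_latticeD S.j_mem_latticeD hw h1
  have hint (n a' b' c' d' : ℤ) (ha : a = n * a') (hb : b = n * b') (hc : c = n * c')
      (hd : d = n * d') (g) (hg : ∀ m, IntActs a' b' c' d' m (dihedralPerm g m)) :
      ∃ g, Acts (⟨a / 2, b / 2, c / 2, d / 2⟩ : ℍ[F,-1,-1]) (dihedralPerm g) := by
    have : (⟨a / 2, b / 2, c / 2, d / 2⟩ : ℍ[F,-1,-1]) = (n / 2 : F) • ⟨a', b', c', d'⟩ := by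
      rw [ha, hb, hc, hd]
      ext <;> simp <;> ring
    rw [this]
    exact ⟨g, (acts_of_intActs hg).smul _⟩
  rcases cases_of_sum_four_squares hsum with h | ⟨rfl, rfl, rfl⟩ | ⟨rfl, rfl, rfl⟩ |
    ⟨rfl, rfl, rfl⟩ | ⟨rfl, rfl, rfl⟩
  · exact absurd h (S.not_odd_of_mem_orderD hw)
  · exact hint a 1 0 0 0 (by simp) (by simp) (by simp) (by simp) 1 (by decide)
  · exact hint b 0 1 0 0 (by simp) (by simp) (by simp) (by simp) (.r 2) (by decide +kernel)
  · exact hint c 0 0 1 0 (by simp) (by simp) (by simp) (by simp) (.sr 0) (by decide +kernel)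
  · exact hint d 0 0 0 1 (by simp) (by simp) (by simp) (by simp) (.sr 2) (by decide +kernel)

theorem redUnitIso_orderD (S : Ramified F) : RedUnitIso F S.orderD (DihedralGroup 4) := by
  have hO := S.isOrder_orderD
  have hα : S.α ∈ S.orderD := S.α_mem_latticeD
  have hj : ⟨0, 0, 1, 0⟩ ∈ S.orderD := S.j_mem_latticeD
  have hr (i : ZMod 4) : dihedralPerm (.r i) = permα ^ i.val := rfl
  have hsr (i : ZMod 4) : dihedralPerm (.sr i) = permJ * permα ^ i.val := rfl
  refine redUnitIso_of_acts S.σ hO dihedralPerm dihedralPerm_injective (fun u => ?_) (fun g => ?_)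
  · obtain ⟨w, hw, h1, c, hc, h⟩ := S.exists_normOne hO hα u
    obtain ⟨g, hg⟩ := S.exists_acts_orderD hw h1
    rcases S.acts_of_smul_eq hc h hg with h | h
    · exact ⟨_, h⟩
    · exact ⟨g * .r 1, by rwa [map_mul, hr, ZMod.val_one'' (by decide), pow_one]⟩
  · obtain ⟨uα, hα⟩ := S.exists_unit_α hO hα
    obtain ⟨uj, hj⟩ := exists_unit_j hO hj
    rcases g with i | i
    · refine ⟨uα ^ i.val, ?_⟩
      rw [hr, Units.val_pow_eq_pow_val, Subring.coe_pow, hα]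
      exact S.acts_α.pow _
    · refine ⟨uj * uα ^ i.val, ?_⟩
      rw [hsr, Units.val_mul, Units.val_pow_eq_pow_val, Subring.coe_mul, Subring.coe_pow, hα, hj]
      exact acts_J.mul (S.acts_α.pow _)

end Ramified

section TypeNumbers

variable {F}

theorem conjRel_map {H : Type} [Ring H] [Algebra F H] (σ : F →+* ℝ) (e e' : ℍ[F,-1,-1] ≃ₐ[F] H)
    (O : Subring ℍ[F,-1,-1]) :
    ConjRel (O.map (e : ℍ[F,-1,-1] →+* H)) (O.map (e' : ℍ[F,-1,-1] →+* H)) := by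
  obtain ⟨y, hy0, hy⟩ := exists_intertwiner ((e'.trans e.symm : _ ≃ₐ[F] _) : _ →ₐ[F] _)
  obtain ⟨x, hx⟩ := (isUnit_of_ne_zero σ hy0).map e
  have key (q : ℍ[F,-1,-1]) : (x : H) * e q * ((x⁻¹ : Hˣ) : H) = e' q := by
    rw [Units.mul_inv_eq_iff_eq_mul, hx, ← map_mul, hy, map_mul]
    simp
  refine ⟨x, fun z => ?_⟩
  obtain ⟨q, rfl⟩ := e.surjective z
  rw [key]
  simp [Subring.mem_map]

theorem RedUnitIso.card_eq {H : Type} [Ring H] [Algebra F H] {O : Subring H}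
    {G G' : Type*} [Group G] [Group G'] (h : RedUnitIso F O G) (h' : RedUnitIso F O G') :
    Nat.card G = Nat.card G' := by
  obtain ⟨φ, hφ, hker⟩ := h
  obtain ⟨φ', hφ', hker'⟩ := h'
  have : φ.ker = φ'.ker := by
    ext u
    rw [MonoidHom.mem_ker, MonoidHom.mem_ker, hker, hker']
  rw [← Nat.card_congr (QuotientGroup.quotientKerEquivOfSurjective φ hφ).toEquiv,
    ← Nat.card_congr (QuotientGroup.quotientKerEquivOfSurjective φ' hφ').toEquiv, this]

theorem typeNum_eq_zero {H : Type} [Ring H] [Algebra F H] {G : Type*} [Group G]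
    (h : ∀ O : Subring H, IsMaximalOrder F O → ¬ RedUnitIso F O G) : typeNum F H G = 0 := by
  have : IsEmpty {O : Subring H // IsMaximalOrder F O ∧ RedUnitIso F O G} :=
    ⟨fun O => h O.1 O.2.1 O.2.2⟩
  exact Nat.card_of_isEmpty

theorem RealQuadratic.typeNum_eq_zero (S : RealQuadratic F) {H : Type} [Ring H] [Algebra F H]
    (hH : IsQuatAlg F H) (hdef : TotallyDefinite F H) {G : Type*} [Group G] {r s : G}
    (h4 : r ^ 4 = 1) (h2 : r ^ 2 ≠ 1) (hrs : s * r * s⁻¹ * r = 1)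
    (h : ¬(Nonempty (H ≃ₐ[F] ℍ[F,-1,-1]) ∧
      ∃ t : F, 2 * algebraMap (𝓞 F) F ↑S.ε = t ^ 2)) : typeNum F H G = 0 := by
  refine QuatPaper.typeNum_eq_zero fun O hO hG => h ?_
  obtain ⟨t, ht⟩ := hG.exists_sqrt hO.1 hH S h4 h2
  obtain ⟨e, -, -⟩ := hG.exists_standard_equiv hO.1 hH hdef ⟨S, t, ht⟩ h4 h2 hrs
  refine ⟨⟨e.symm⟩, (t : F), ?_⟩
  have := congrArg (algebraMap (𝓞 F) F) ht
  rw [map_pow, map_mul, map_ofNat] at this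
  exact this.symm

theorem Ramified.typeNum_eq_one (S : Ramified F) {H : Type} [Ring H] [Algebra F H]
    (hH : IsQuatAlg F H) (hdef : TotallyDefinite F H) (e : ℍ[F,-1,-1] ≃ₐ[F] H)
    {G : Type*} [Group G] {r s : G}
    (h4 : r ^ 4 = 1) (h2 : r ^ 2 ≠ 1) (hrs : s * r * s⁻¹ * r = 1) {O₀ : Subring ℍ[F,-1,-1]}
    (hmax : IsMaximalOrder F O₀) (hG : RedUnitIso F O₀ G)
    (huniq : ∀ O, IsMaximalOrder F O → RedUnitIso F O G → S.α ∈ O → ⟨0, 0, 1, 0⟩ ∈ O → O = O₀) :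
    typeNum F H G = 1 := by
  have key (O : Subring H) (hO : IsMaximalOrder F O) (hOG : RedUnitIso F O G) :
      ∃ f : ℍ[F,-1,-1] ≃ₐ[F] H, O₀.map (f : ℍ[F,-1,-1] →+* H) = O := by
    obtain ⟨f, hα, hj⟩ := hOG.exists_standard_equiv hO.1 hH hdef S h4 h2 hrs
    have h := huniq _ (hO.map f.symm) (hOG.map f.symm) ⟨_, hα, f.symm_apply_apply _⟩
      ⟨_, hj, f.symm_apply_apply _⟩
    exact ⟨f, by rw [← h]; exact map_symm_map f.symm O⟩
  rw [typeNum, Nat.card_eq_one_iff_unique]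
  refine ⟨⟨?_⟩, ⟨Quot.mk _ ⟨_, hmax.map e, hG.map e⟩⟩⟩
  rintro ⟨O, hO, hOG⟩ ⟨O', hO', hOG'⟩
  obtain ⟨f, rfl⟩ := key O hO hOG
  obtain ⟨f', rfl⟩ := key O' hO' hOG'
  exact Quot.sound (conjRel_map S.σ f f' O₀)

theorem Ramified.typeNum_S4_eq_one (S : Ramified F) {H : Type} [Ring H] [Algebra F H]
    (hH : IsQuatAlg F H) (hdef : TotallyDefinite F H) (e : ℍ[F,-1,-1] ≃ₐ[F] H) :
    typeNum F H (Equiv.Perm (Fin 4)) = 1 := by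
  refine S.typeNum_eq_one hH hdef e (r := permα) (s := permJ) (by decide) (by decide) (by decide)
    S.isMaximalOrder_orderS S.redUnitIso_orderS fun O hO hG hα hj => ?_
  refine (S.eq_orderS_or_eq_orderD hO hα hj).resolve_right fun h => ?_
  have := (h ▸ hG).card_eq S.redUnitIso_orderD
  rw [Nat.card_perm, DihedralGroup.nat_card] at this
  simp [Nat.factorial] at this

theorem Ramified.typeNum_D4_eq_one (S : Ramified F) {H : Type} [Ring H] [Algebra F H]
    (hH : IsQuatAlg F H) (hdef : TotallyDefinite F H) (e : ℍ[F,-1,-1] ≃ₐ[F] H) :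
    typeNum F H (DihedralGroup 4) = 1 := by
  refine S.typeNum_eq_one hH hdef e (r := .r 1) (s := .sr 0) (by decide) (by decide) (by decide)
    S.isMaximalOrder_orderD S.redUnitIso_orderD fun O hO hG hα hj => ?_
  refine (S.eq_orderS_or_eq_orderD hO hα hj).resolve_left fun h => ?_
  have := (h ▸ hG).card_eq S.redUnitIso_orderS
  rw [Nat.card_perm, DihedralGroup.nat_card] at this
  simp [Nat.factorial] at this

end TypeNumbers

/-- **Refined type number for `S₄` and `D₄`** -/
theorem typeNum_S4_eq_typeNum_D4
    (d : ℕ) (hd6 : 6 ≤ d) (hdsf : Squarefree d)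
    (sqrtd : F) (hsqrtd : sqrtd ^ 2 = (d : F))
    (hgen : Algebra.adjoin ℚ {sqrtd} = ⊤)
    (σ₀ : F →+* ℝ) (hσ₀ : 0 < σ₀ sqrtd)
    -- `ε` is the fundamental unit of `F`: the smallest unit greater than `1`
    (ε : (𝓞 F)ˣ) (hε : 1 < σ₀ (algebraMap (𝓞 F) F ↑ε))
    (hεfund : ∀ u : (𝓞 F)ˣ, 1 < σ₀ (algebraMap (𝓞 F) F ↑u) →
      σ₀ (algebraMap (𝓞 F) F ↑ε) ≤ σ₀ (algebraMap (𝓞 F) F ↑u))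
    (H : Type) [Ring H] [Algebra F H]
    (hquat : IsQuatAlg F H) (hdef : TotallyDefinite F H) :
    typeNum F H (Equiv.Perm (Fin 4)) = typeNum F H (DihedralGroup 4) ∧
    (Nonempty (H ≃ₐ[F] ℍ[F, -1, -1]) ∧
        (∃ t : F, 2 * algebraMap (𝓞 F) F ↑ε = t ^ 2) →
      typeNum F H (Equiv.Perm (Fin 4)) = 1 ∧ typeNum F H (DihedralGroup 4) = 1) ∧
    (¬(Nonempty (H ≃ₐ[F] ℍ[F, -1, -1]) ∧
        (∃ t : F, 2 * algebraMap (𝓞 F) F ↑ε = t ^ 2)) →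
      typeNum F H (Equiv.Perm (Fin 4)) = 0 ∧ typeNum F H (DihedralGroup 4) = 0) := by
  let S : RealQuadratic F := ⟨d, hd6, hdsf, sqrtd, hsqrtd, hgen, σ₀, ε, hε, hεfund⟩
  have pos : Nonempty (H ≃ₐ[F] ℍ[F, -1, -1]) ∧
      (∃ t : F, 2 * algebraMap (𝓞 F) F ↑ε = t ^ 2) →
      typeNum F H (Equiv.Perm (Fin 4)) = 1 ∧ typeNum F H (DihedralGroup 4) = 1 := by
    rintro ⟨⟨e⟩, t, ht⟩
    have hint : IsIntegral ℤ t := IsIntegral.of_pow two_pos <| by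
      have h2 : algebraMap (𝓞 F) F (2 * (ε : 𝓞 F)) = t ^ 2 := by rw [map_mul, map_ofNat, ht]
      rw [← h2]
      exact RingOfIntegers.isIntegral_coe _
    obtain ⟨t, rfl⟩ : ∃ t' : 𝓞 F, algebraMap (𝓞 F) F t' = t := ⟨⟨t, hint⟩, rfl⟩
    have ht' : t ^ 2 = 2 * (ε : 𝓞 F) := by
      refine RingOfIntegers.coe_injective ?_
      rw [map_pow, map_mul, map_ofNat, ht]
    let R : Ramified F := ⟨S, t, ht'⟩
    exact ⟨R.typeNum_S4_eq_one hquat hdef e.symm, R.typeNum_D4_eq_one hquat hdef e.symm⟩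
  have neg (h : ¬(Nonempty (H ≃ₐ[F] ℍ[F, -1, -1]) ∧
      (∃ t : F, 2 * algebraMap (𝓞 F) F ↑ε = t ^ 2))) :
      typeNum F H (Equiv.Perm (Fin 4)) = 0 ∧ typeNum F H (DihedralGroup 4) = 0 :=
    ⟨S.typeNum_eq_zero hquat hdef (r := permα) (s := permJ) (by decide) (by decide) (by decide) h,
      S.typeNum_eq_zero hquat hdef (r := .r 1) (s := .sr 0) (by decide) (by decide) (by decide) h⟩
  refine ⟨?_, pos, neg⟩
  by_cases h : Nonempty (H ≃ₐ[F] ℍ[F, -1, -1]) ∧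
      (∃ t : F, 2 * algebraMap (𝓞 F) F ↑ε = t ^ 2)
  · rw [(pos h).1, (pos h).2]
  · rw [(neg h).1, (neg h).2]

end QuatPaper
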